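/- arXiv:1808.08679 — 2 statements merged into one kernel-verified Lean document; each statement's English description precedes it below -/
import Mathlib

section
/- For all positive integers m, n and every nonnegative integer d, the following identity of polynomials in x_1,…,x_n, y_1,…,y_m holds: the sum over all partitions λ of d of s_{λ'}(x_1,…,x_n)·s_λ(y_1,…,y_m) equals the elementary symmetric polynomial of degree d in the mn variables {x_i y_j : 1 ≤ i ≤ n, 1 ≤ j ≤ m}, i.e. the sum over all n×m matrices A = (a_{ij}) with entries in {0,1} and total sum d of ∏_{i,j} (x_i y_j)^{a_{ij}}. -/
/-- The weight of a semistandard Young tableau: `ssytWeight T i` is the number of cells of the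
tableau whose entry equals `i`. -/
def ssytWeight {μ : YoungDiagram} (T : SemistandardYoungTableau μ) (i : ℕ) : ℕ :=
  (μ.cells.filter fun c => T c.1 c.2 = i).card

/-- `tabCard μ ν` is the number of semistandard Young tableaux of shape `μ` and weight `ν`,
where `ν : Fin n → ℕ`: the entry `j` (for `j < n`) occurs exactly `ν j` times, and no entry
`≥ n` occurs. -/
noncomputable def tabCard (μ : YoungDiagram) {n : ℕ} (ν : Fin n → ℕ) : ℕ :=
  Set.ncard {T : SemistandardYoungTableau μ |
    ∀ j : ℕ, ssytWeight T j = if h : j < n then ν ⟨j, h⟩ else 0}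

/-- The Schur polynomial `s_μ(x_0, …, x_{n-1})`, as the generating function of semistandard
Young tableaux of shape `μ` with entries in `{0, …, n-1}`. -/
noncomputable def schurPoly (n : ℕ) (μ : YoungDiagram) : MvPolynomial (Fin n) ℤ :=
  ∑ᶠ (T : SemistandardYoungTableau μ) (_ : ∀ c ∈ μ.cells, T c.1 c.2 < n),
    ∏ i : Fin n, (MvPolynomial.X i : MvPolynomial (Fin n) ℤ) ^ ssytWeight T (i : ℕ)

/-- The number of odd rows (odd parts) of a Young diagram. -/
def oddRowsCount (lam : YoungDiagram) : ℕ :=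
  lam.rowLens.countP fun r => r % 2 = 1

/-- The number of odd columns of a Young diagram. -/
def oddColsCount (lam : YoungDiagram) : ℕ :=
  oddRowsCount lam.transpose

/-- A Young diagram is a *threshold* partition if its Frobenius coordinates satisfy
`β i = α i + 1` for each `i` up to the Durfee rank; with 0-indexed diagrams this says that
`colLen i = rowLen i + 1` for each diagonal cell `(i, i)`. -/
def YoungDiagram.IsThreshold (lam : YoungDiagram) : Prop :=
  ∀ i : ℕ, (i, i) ∈ lam → lam.colLen i = lam.rowLen i + 1

section GelfandTsetlin

open Finset

variable {R : Type*} [CommRing R]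

/-- The generating function of Gelfand–Tsetlin patterns with top row `f`, in the variables
`y 0, …, y (m - 1)`. -/
def gelfandTsetlinSum (y : ℕ → R) : ∀ m : ℕ, (Fin m → ℕ) → R
  | 0, _ => 1
  | m + 1, f =>
    ∑ g ∈ Fintype.piFinset fun i : Fin m => Icc (f i.succ) (f i.castSucc),
      gelfandTsetlinSum y m g *
        ((∏ i : Fin m, y m ^ (f i.castSucc - g i)) * y m ^ f (Fin.last m))

/-- The generating function of chains of `n` vertical strips ending at `f`, in the variables
`x 0, …, x (n - 1)`. -/
noncomputable def verticalStripSum {m : ℕ} (x : ℕ → R) : ℕ → (Fin m → ℕ) → R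
  | 0, f => by classical exact if f = 0 then 1 else 0
  | n + 1, f => by
    classical exact
    ∑ k ∈ (Fintype.piFinset fun i : Fin m => Icc (f i - 1) (f i)).filter Antitone,
      verticalStripSum x n k * ∏ i : Fin m, x n ^ (f i - k i)

theorem antitone_of_gelfandTsetlinSum_ne_zero {y : ℕ → R} {m : ℕ} {f : Fin m → ℕ}
    (h : gelfandTsetlinSum y m f ≠ 0) : Antitone f := by
  cases m with
  | zero => exact Subsingleton.antitone f
  | succ m =>
    rw [gelfandTsetlinSum] at h
    obtain ⟨g, hg, -⟩ := exists_ne_zero_of_sum_ne_zero h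
    simp only [Fintype.mem_piFinset, mem_Icc] at hg
    exact Fin.antitone_iff_succ_le.2 fun i => (hg i).1.trans (hg i).2

theorem prod_mul_last_eq_zero_mul_prod {m : ℕ} (L K : Fin m → R) (b : Fin (m + 1) → R)
    (h : ∀ i, L i * b i.succ = K i * b i.castSucc) :
    (∏ i, L i) * b (Fin.last m) = b 0 * ∏ i, K i := by
  induction m with
  | zero => simp
  | succ m ih =>
    have := ih (fun i => L i.castSucc) (fun i => K i.castSucc) (fun i => b i.castSucc)
      fun i => h i.castSucc
    rw [Fin.prod_univ_castSucc, Fin.prod_univ_castSucc, ← mul_assoc, ← Fin.castSucc_zero, ← this,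
      mul_assoc, ← Fin.succ_last, h]
    ring

/-- The contribution of a row to the sum over diagrams obtained by adding strips. -/
def rowAddSum (x y : R) (a b c : ℕ) : R :=
  ∑ h ∈ (Icc a (a + 1)).filter fun h => b ≤ h ∧ h ≤ c, x ^ (h - a) * y ^ (h - b)

/-- The contribution of a row to the sum over diagrams obtained by removing strips. -/
def rowRemoveSum (x y : R) (a b a' : ℕ) : R :=
  ∑ k ∈ (Icc a' a).filter fun k => k ≤ b ∧ b ≤ k + 1, x ^ (b - k) * y ^ (a - k)

/-- The factor transferred between consecutive rows. -/
def rowFactor (x y : R) (a c : ℕ) : R :=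
  if a < c then 1 + x * y else if a = c then 1 else 0

theorem rowAddSum_of_le (x y : R) {a b : ℕ} (c : ℕ) (h : b ≤ a) :
    rowAddSum x y a b c = y ^ (a - b) * rowFactor x y a c := by
  have e : Icc a (a + 1) = {a, a + 1} := by ext z; simp; omega
  have e' : a + 1 - b = a - b + 1 := by omega
  have h' : b ≤ a + 1 := by omega
  rw [rowAddSum, rowFactor, sum_filter, e, sum_pair (by omega)]
  rcases lt_trichotomy a c with hc | hc | hc
  · have h1 : a + 1 ≤ c := hc
    simp [h, h', h1, hc, hc.le, e', pow_succ]; ring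
  · simp [hc]; omega
  · have h1 : ¬ a + 1 ≤ c := by omega
    have h2 : ¬ a ≤ c := by omega
    have h3 : ¬ a < c := by omega
    simp [h1, h2, h3, hc.ne']

theorem rowRemoveSum_of_le (x y : R) {a b : ℕ} (a' : ℕ) (h : b ≤ a) :
    rowRemoveSum x y a b a' = y ^ (a - b) * rowFactor x y a' b := by
  rw [rowRemoveSum, rowFactor]
  rcases lt_trichotomy a' b with hc | hc | hc
  · have e : ((Icc a' a).filter fun k => k ≤ b ∧ b ≤ k + 1) = {b, b - 1} := by
      ext z; simp; omega
    have e' : a - (b - 1) = a - b + 1 := by omega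
    have e2 : b - (b - 1) = 1 := by omega
    rw [e, sum_pair (by omega), e', e2, if_pos hc]
    simp [pow_succ]; ring
  · have e : ((Icc a' a).filter fun k => k ≤ b ∧ b ≤ k + 1) = {b} := by
      ext z; simp; omega
    rw [e]; simp [hc]
  · have e : ((Icc a' a).filter fun k => k ≤ b ∧ b ≤ k + 1) = ∅ := by
      ext z; simp; omega
    simp [e, hc.ne', hc.le]

theorem rowAddSum_mul_rowFactor (x y : R) {a b c a' : ℕ} (hb : b ≤ c) (ha : a' ≤ a) :
    rowAddSum x y a b c * rowFactor x y a' b = rowRemoveSum x y a b a' * rowFactor x y a c := by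
  rcases le_or_gt b a with h | h
  · rw [rowAddSum_of_le x y c h, rowRemoveSum_of_le x y a' h]; ring
  rcases eq_or_ne b (a + 1) with rfl | h'
  · have e : ((Icc a (a + 1)).filter fun h => a + 1 ≤ h ∧ h ≤ c) = {a + 1} := by
      ext z; simp; omega
    have e2 : ((Icc a' a).filter fun k => k ≤ a + 1 ∧ a + 1 ≤ k + 1) = {a} := by
      ext z; simp; omega
    have h1 : a' < a + 1 := by omega
    have h2 : a < c := by omega
    rw [rowAddSum, rowRemoveSum, e, e2]; simp [rowFactor, h1, h2]
  · have e : ((Icc a (a + 1)).filter fun h => b ≤ h ∧ h ≤ c) = ∅ := by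
      ext z; simp; omega
    have e2 : ((Icc a' a).filter fun k => k ≤ b ∧ b ≤ k + 1) = ∅ := by
      ext z; simp; omega
    simp [rowAddSum, rowRemoveSum, e, e2]

theorem sum_add_strips_eq_mul_sum_remove_strips (x y : R) {m : ℕ} {f : Fin (m + 1) → ℕ}
    (hf : Antitone f) {g : Fin m → ℕ} (hg : Antitone g) (hgf : ∀ i, g i ≤ f 0 + 1) :
    ∑ h ∈ (Fintype.piFinset fun i => Icc (f i) (f i + 1)).filter
        (fun h => ∀ i : Fin m, h i.succ ≤ g i ∧ g i ≤ h i.castSucc),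
      (∏ i, x ^ (h i - f i)) *
        ((∏ i : Fin m, y ^ (h i.castSucc - g i)) * y ^ h (Fin.last m)) =
    (1 + x * y) *
      ∑ k ∈ (Fintype.piFinset fun i : Fin m => Icc (f i.succ) (f i.castSucc)).filter
        (fun k => ∀ i : Fin m, k i ≤ g i ∧ g i ≤ k i + 1),
      (∏ i, x ^ (g i - k i)) *
        ((∏ i : Fin m, y ^ (f i.castSucc - k i)) * y ^ f (Fin.last m)) := by
  set q : Fin (m + 1) → ℕ := Fin.snoc g 0 with hq
  set p : Fin (m + 1) → ℕ := Fin.cons (f 0 + 1) g with hp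
  have hL : ((Fintype.piFinset fun i => Icc (f i) (f i + 1)).filter
      (fun h => ∀ i : Fin m, h i.succ ≤ g i ∧ g i ≤ h i.castSucc)) =
      Fintype.piFinset fun i => (Icc (f i) (f i + 1)).filter fun h => q i ≤ h ∧ h ≤ p i := by
    ext h
    simp only [mem_filter, Fintype.mem_piFinset, forall_and]
    refine and_congr_right fun hh => ?_
    rw [Fin.forall_fin_succ' (P := fun i => q i ≤ h i),
      Fin.forall_fin_succ (P := fun i => h i ≤ p i)]
    have := (mem_Icc.1 (hh 0)).2
    simp [hq, hp, this, and_comm]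
  have hK : ((Fintype.piFinset fun i : Fin m => Icc (f i.succ) (f i.castSucc)).filter
      (fun k => ∀ i : Fin m, k i ≤ g i ∧ g i ≤ k i + 1)) =
      Fintype.piFinset fun i : Fin m => (Icc (f i.succ) (f i.castSucc)).filter
        fun k => k ≤ g i ∧ g i ≤ k + 1 := by
    ext h
    simp only [mem_filter, Fintype.mem_piFinset, forall_and]
  have hl : ∀ h : Fin (m + 1) → ℕ, (∏ i, x ^ (h i - f i)) *
        ((∏ i : Fin m, y ^ (h i.castSucc - g i)) * y ^ h (Fin.last m)) =
        ∏ i, (x ^ (h i - f i) * y ^ (h i - q i)) := by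
    intro h
    rw [prod_mul_distrib]
    congr 1
    rw [Fin.prod_univ_castSucc]
    simp [hq]
  have hk : ∀ k : Fin m → ℕ, (∏ i, x ^ (g i - k i)) *
        ((∏ i : Fin m, y ^ (f i.castSucc - k i)) * y ^ f (Fin.last m)) =
        (∏ i, (x ^ (g i - k i) * y ^ (f i.castSucc - k i))) * y ^ f (Fin.last m) := by
    intro k
    rw [prod_mul_distrib, mul_assoc]
  rw [hL, hK]
  simp_rw [hl, hk]
  have hadd := prod_univ_sum (t := fun i => (Icc (f i) (f i + 1)).filter
    fun h => q i ≤ h ∧ h ≤ p i) (f := fun i h => x ^ (h - f i) * y ^ (h - q i))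
  have hrem := prod_univ_sum (t := fun i : Fin m => (Icc (f i.succ) (f i.castSucc)).filter
    fun k => k ≤ g i ∧ g i ≤ k + 1) (f := fun i k => x ^ (g i - k) * y ^ (f i.castSucc - k))
  rw [← sum_mul, ← hadd, ← hrem]
  change ∏ i, rowAddSum x y (f i) (q i) (p i) =
    (1 + x * y) * ((∏ i : Fin m, rowRemoveSum x y (f i.castSucc) (g i) (f i.succ)) * _)
  have key := prod_mul_last_eq_zero_mul_prod
    (fun i : Fin m => rowAddSum x y (f i.castSucc) (g i) (p i.castSucc))
    (fun i : Fin m => rowRemoveSum x y (f i.castSucc) (g i) (f i.succ))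
    (fun i => rowFactor x y (f i) (p i)) (fun i => by
      have hpi : p i.succ = g i := by simp [hp]
      rw [hpi]
      refine rowAddSum_mul_rowFactor x y ?_ (hf i.castSucc_le_succ)
      have : Antitone p := by
        refine Fin.antitone_iff_succ_le.2 fun j => ?_
        cases m with
        | zero => exact j.elim0
        | succ m =>
          refine Fin.cases ?_ (fun j => ?_) j
          · simpa [hp] using hgf 0
          · rw [← Fin.succ_castSucc]
            simpa [hp] using hg j.castSucc_le_succ
      simpa [hpi] using this i.castSucc_le_succ)
  rw [Fin.prod_univ_castSucc]
  have h0 : rowFactor x y (f 0) (p 0) = 1 + x * y := by simp [rowFactor, hp]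
  have hlast : q (Fin.last m) = 0 := by simp [hq]
  simp only [h0] at key
  rw [hlast, rowAddSum_of_le x y _ (Nat.zero_le _),
    ← mul_assoc (1 + x * y), ← key]
  simp only [hq, Fin.snoc_castSucc, Nat.sub_zero]
  ring

theorem sum_vertical_strips_gelfandTsetlinSum (x : R) (y : ℕ → R) {m : ℕ} {f : Fin m → ℕ}
    (hf : Antitone f) :
    ∑ h ∈ Fintype.piFinset fun i => Icc (f i) (f i + 1),
        (∏ i, x ^ (h i - f i)) * gelfandTsetlinSum y m h =
      (∏ j ∈ range m, (1 + x * y j)) * gelfandTsetlinSum y m f := by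
  classical
  induction m with
  | zero => simp [gelfandTsetlinSum]
  | succ m ih =>
    simp only [gelfandTsetlinSum, mul_sum]
    have hS : ∀ g : Fin m → ℕ, g ∈ (Fintype.piFinset fun i : Fin m => range (f 0 + 2)) ↔
        ∀ i, g i ≤ f 0 + 1 := by
      intro g
      simp only [Fintype.mem_piFinset, mem_range]
      exact forall_congr' fun i => by omega
    have hf0 : ∀ i, f i ≤ f 0 := fun i => hf (Fin.zero_le i)
    rw [sum_comm' (t' := (Fintype.piFinset fun i : Fin m => range (f 0 + 2)).filter Antitone)
      (s' := fun g => (Fintype.piFinset fun i => Icc (f i) (f i + 1)).filter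
        (fun h => ∀ i : Fin m, h i.succ ≤ g i ∧ g i ≤ h i.castSucc))]
    swap
    · intro h g
      simp only [mem_filter, hS, Fintype.mem_piFinset, mem_Icc]
      constructor
      · rintro ⟨h1, h2⟩
        refine ⟨⟨h1, h2⟩, fun i => ?_, ?_⟩
        · have := (h2 i).2
          have := (h1 i.castSucc).2
          have := hf0 i.castSucc
          omega
        · cases m with
          | zero => exact Subsingleton.antitone g
          | succ m =>
            refine Fin.antitone_iff_succ_le.2 fun i => ?_
            have := (h2 i.succ).2
            have := (h2 i.castSucc).1
            rw [Fin.succ_castSucc] at this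
            omega
      · rintro ⟨⟨h1, h2⟩, -⟩
        exact ⟨h1, h2⟩
    have hL : ∀ g ∈ (Fintype.piFinset fun i : Fin m => range (f 0 + 2)).filter Antitone,
        ∑ h ∈ (Fintype.piFinset fun i => Icc (f i) (f i + 1)).filter
            (fun h => ∀ i : Fin m, h i.succ ≤ g i ∧ g i ≤ h i.castSucc),
          (∏ i, x ^ (h i - f i)) * (gelfandTsetlinSum y m g *
            ((∏ i : Fin m, y m ^ (h i.castSucc - g i)) * y m ^ h (Fin.last m))) =
        ∑ k ∈ (Fintype.piFinset fun i : Fin m => Icc (f i.succ) (f i.castSucc)).filter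
            (fun k => ∀ i : Fin m, k i ≤ g i ∧ g i ≤ k i + 1),
          (1 + x * y m) * ((∏ i, x ^ (g i - k i)) * gelfandTsetlinSum y m g *
            ((∏ i : Fin m, y m ^ (f i.castSucc - k i)) * y m ^ f (Fin.last m))) := by
      intro g hg
      rw [mem_filter, hS] at hg
      have := congrArg (gelfandTsetlinSum y m g * ·)
        (sum_add_strips_eq_mul_sum_remove_strips x (y m) hf hg.2 hg.1)
      simp only [mul_sum] at this
      refine Eq.trans (sum_congr rfl fun h _ => ?_) (this.trans (sum_congr rfl fun k _ => ?_)) <;>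
        ring
    rw [sum_congr rfl hL]
    rw [← sum_comm' (s := Fintype.piFinset fun i : Fin m => Icc (f i.succ) (f i.castSucc))
      (t := fun k => (Fintype.piFinset fun i => Icc (k i) (k i + 1)).filter Antitone)]
    swap
    · intro k g
      simp only [mem_filter, hS, Fintype.mem_piFinset, mem_Icc]
      constructor
      · rintro ⟨h1, h2, h3⟩
        refine ⟨⟨h1, h2⟩, fun i => ?_, h3⟩
        have := (h2 i).2
        have := (h1 i).2
        have := hf0 i.castSucc
        omega
      · rintro ⟨⟨h1, h2⟩, -, h3⟩
        exact ⟨h1, h2, h3⟩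
    refine sum_congr rfl fun k hk => ?_
    simp only [Fintype.mem_piFinset, mem_Icc] at hk
    have hka : Antitone k := by
      cases m with
      | zero => exact Subsingleton.antitone k
      | succ m =>
        refine Fin.antitone_iff_succ_le.2 fun i => ?_
        have := (hk i.succ).2
        have := (hk i.castSucc).1
        rw [Fin.succ_castSucc] at this
        omega
    rw [sum_filter_of_ne fun g _ hne => antitone_of_gelfandTsetlinSum_ne_zero fun h0 =>
      hne (by rw [h0]; ring)]
    rw [← mul_sum, ← sum_mul, ih hka, prod_range_succ]
    ring

theorem le_of_verticalStripSum_ne_zero {x : ℕ → R} {m n : ℕ} {f : Fin m → ℕ}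
    (h : verticalStripSum x n f ≠ 0) (i : Fin m) : f i ≤ n := by
  induction n generalizing f with
  | zero =>
    rw [verticalStripSum] at h
    have : f = 0 := by by_contra h0; simp [h0] at h
    simp [this]
  | succ n ih =>
    rw [verticalStripSum] at h
    obtain ⟨k, hk, hne⟩ := exists_ne_zero_of_sum_ne_zero h
    have := ih (left_ne_zero_of_mul hne)
    simp only [Fintype.mem_piFinset, mem_Icc, mem_filter] at hk
    have := (hk.1 i).1
    omega

open Classical in
theorem sum_verticalStripSum_mul_gelfandTsetlinSum (x y : ℕ → R) (m : ℕ) {n N : ℕ} (hN : n ≤ N) :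
    ∑ f ∈ (Fintype.piFinset fun _ : Fin m => range (N + 1)).filter Antitone,
        verticalStripSum x n f * gelfandTsetlinSum y m f =
      ∏ i ∈ range n, ∏ j ∈ range m, (1 + x i * y j) := by
  induction n with
  | zero =>
    rw [sum_eq_single (0 : Fin m → ℕ)]
    · have : ∀ m : ℕ, gelfandTsetlinSum y m 0 = 1 := by
        intro m
        induction m with
        | zero => simp [gelfandTsetlinSum]
        | succ m ih =>
          have e : (Fintype.piFinset fun _ : Fin m => Icc 0 0) = {(0 : Fin m → ℕ)} := by
            ext g; simp [funext_iff]
          simp only [gelfandTsetlinSum, Pi.zero_apply, e, sum_singleton]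
          simp [ih]
      simp [verticalStripSum, this]
    · intro f _ hf
      simp [verticalStripSum, hf]
    · intro h
      exact absurd (by simp [mem_filter, antitone_const, Pi.zero_def]) h
  | succ n ih =>
    rw [prod_range_succ, ← ih (by omega), sum_mul]
    simp only [verticalStripSum, sum_mul]
    rw [sum_comm' (t' := (Fintype.piFinset fun _ : Fin m => range (N + 1)).filter Antitone)
      (s' := fun k => ((Fintype.piFinset fun i => Icc (k i) (k i + 1)).filter
        fun f => ∀ i, f i < N + 1).filter Antitone)]
    swap
    · intro f k
      simp only [mem_filter, Fintype.mem_piFinset, mem_Icc, mem_range]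
      constructor
      · rintro ⟨⟨h1, h2⟩, h3, h4⟩
        refine ⟨⟨⟨fun i => ?_, h1⟩, h2⟩, fun i => ?_, h4⟩ <;> have := h3 i <;> have := h1 i <;> omega
      · rintro ⟨⟨⟨h1, h2⟩, h3⟩, h4, h5⟩
        refine ⟨⟨h2, h3⟩, fun i => ?_, h5⟩
        have := h1 i
        omega
    refine sum_congr rfl fun k hk => ?_
    rcases eq_or_ne (verticalStripSum x n k) 0 with h0 | h0
    · simp [h0]
    have hkn := le_of_verticalStripSum_ne_zero h0
    rw [sum_filter_of_ne fun g _ hne => antitone_of_gelfandTsetlinSum_ne_zero fun h0 =>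
      hne (by rw [h0]; ring)]
    rw [filter_true_of_mem fun f hf i => by
      simp only [Fintype.mem_piFinset, mem_Icc] at hf
      have := (hf i).2
      have := hkn i
      omega]
    simp_rw [mul_assoc]
    rw [← mul_sum, sum_vertical_strips_gelfandTsetlinSum _ _ (mem_filter.1 hk).2]
    ring

end GelfandTsetlin

namespace YoungDiagram

open Finset

theorem ext_rowLen {μ ν : YoungDiagram} (h : ∀ i, μ.rowLen i = ν.rowLen i) : μ = ν :=
  SetLike.ext fun ⟨i, j⟩ => by rw [mem_iff_lt_rowLen, mem_iff_lt_rowLen, h]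

theorem le_iff_rowLen_le {μ ν : YoungDiagram} : μ ≤ ν ↔ ∀ i, μ.rowLen i ≤ ν.rowLen i := by
  constructor
  · intro h i
    by_contra! hlt
    exact lt_irrefl _ (mem_iff_lt_rowLen.1 (h (mem_iff_lt_rowLen.2 hlt)))
  · rintro h ⟨i, j⟩ hc
    exact mem_iff_lt_rowLen.2 ((mem_iff_lt_rowLen.1 hc).trans_le (h i))

theorem rowLen_eq_zero_of_le {μ : YoungDiagram} {i j : ℕ} (h : μ.rowLen i = 0) (hij : i ≤ j) :
    μ.rowLen j = 0 :=
  Nat.le_zero.1 (h ▸ μ.rowLen_anti i j hij)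

theorem ext_rowLen_of_lt {m : ℕ} {μ ν : YoungDiagram} (hμ : μ.rowLen m = 0) (hν : ν.rowLen m = 0)
    (h : ∀ i < m, μ.rowLen i = ν.rowLen i) : μ = ν :=
  ext_rowLen fun i => (lt_or_ge i m).elim (h i) fun hi => by
    rw [rowLen_eq_zero_of_le hμ hi, rowLen_eq_zero_of_le hν hi]

theorem antitone_rowLen_fin (μ : YoungDiagram) (m : ℕ) : Antitone fun i : Fin m => μ.rowLen i :=
  fun i j h => μ.rowLen_anti i j h

theorem card_eq_sum_rowLen {m : ℕ} {μ : YoungDiagram} (h : μ.rowLen m = 0) :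
    μ.card = ∑ i : Fin m, μ.rowLen i := by
  rw [← sum_range fun i => μ.rowLen i, YoungDiagram.card,
    card_eq_sum_card_fiberwise (f := Prod.fst) (t := range m)]
  · exact sum_congr rfl fun i _ => (μ.rowLen_eq_card).symm
  · rintro ⟨i, j⟩ hc
    rw [mem_coe, mem_cells, mem_iff_lt_rowLen] at hc
    rw [mem_coe, mem_range]
    by_contra! hm
    rw [rowLen_eq_zero_of_le h hm] at hc
    exact absurd hc (Nat.not_lt_zero _)

theorem card_transpose (μ : YoungDiagram) : μ.transpose.card = μ.card := by
  simp [YoungDiagram.card, transpose]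

theorem finite_Iic (μ : YoungDiagram) : (Set.Iic μ).Finite := by
  refine Set.Finite.of_finite_image (f := cells) (s := Set.Iic μ) ?_ fun a _ b _ h =>
    YoungDiagram.ext h
  refine (μ.cells.powerset.finite_toSet).subset ?_
  rintro _ ⟨ν, hν, rfl⟩
  exact mem_powerset.2 (cells_subset_iff.2 hν)

/-- The Young diagrams obtained from `μ` by removing a horizontal strip. -/
noncomputable def removeHorizontalStrip (μ : YoungDiagram) : Finset YoungDiagram :=
  (μ.finite_Iic.subset (t := {ν | ν ≤ μ ∧ ∀ i j, (i + 1, j) ∈ μ → (i, j) ∈ ν})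
    fun _ h => h.1).toFinset

theorem mem_removeHorizontalStrip {μ ν : YoungDiagram} :
    ν ∈ μ.removeHorizontalStrip ↔ ν ≤ μ ∧ ∀ i j, (i + 1, j) ∈ μ → (i, j) ∈ ν := by
  simp [removeHorizontalStrip]

theorem mem_removeHorizontalStrip_iff_rowLen {μ ν : YoungDiagram} :
    ν ∈ μ.removeHorizontalStrip ↔
      ∀ i, ν.rowLen i ≤ μ.rowLen i ∧ μ.rowLen (i + 1) ≤ ν.rowLen i := by
  rw [mem_removeHorizontalStrip, le_iff_rowLen_le, forall_and]
  refine and_congr_right fun _ => forall_congr' fun i => ?_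
  simp only [mem_iff_lt_rowLen]
  exact ⟨fun h => by by_contra! hlt; exact lt_irrefl _ (h _ hlt), fun h j hj => hj.trans_le h⟩

theorem transpose_mem_removeHorizontalStrip_iff_rowLen {μ ν : YoungDiagram} :
    ν.transpose ∈ μ.transpose.removeHorizontalStrip ↔
      ∀ i, ν.rowLen i ≤ μ.rowLen i ∧ μ.rowLen i - 1 ≤ ν.rowLen i := by
  rw [mem_removeHorizontalStrip, transpose_le_iff, le_iff_rowLen_le, forall_and]
  refine and_congr_right fun _ => ?_
  rw [forall_comm]
  refine forall_congr' fun i => ?_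
  have hmem : ∀ (κ : YoungDiagram) (a b : ℕ), (a, b) ∈ κ.transpose ↔ a < κ.rowLen b :=
    fun κ a b => by rw [mem_transpose, Prod.swap_prod_mk, mem_iff_lt_rowLen]
  simp only [hmem]
  refine ⟨fun h => ?_, fun h j hj => by omega⟩
  by_contra! hlt
  exact lt_irrefl _ (h _ (by omega))

/-- The largest Young diagram with at most `m` rows whose `i`-th row has at most `g i` cells. -/
def ofFinFun {m : ℕ} (g : Fin m → ℕ) : YoungDiagram where
  cells := (univ.biUnion fun i : Fin m => (range (g i)).image fun j => ((i : ℕ), j)).filter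
    fun c => ∀ i : Fin m, (i : ℕ) ≤ c.1 → c.2 < g i
  isLowerSet := by
    rintro ⟨a, b⟩ ⟨a', b'⟩ h hc
    obtain ⟨ha, hb⟩ := Prod.mk_le_mk.1 h
    simp only [coe_filter, mem_biUnion, mem_univ, true_and, mem_image, mem_range,
      Prod.mk.injEq, Set.mem_ofPred_eq] at hc ⊢
    obtain ⟨⟨i, j, hj, rfl, rfl⟩, h2⟩ := hc
    refine ⟨⟨⟨a', ha.trans_lt i.2⟩, b', hb.trans_lt (h2 _ ha), rfl, rfl⟩, fun k hk => ?_⟩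
    exact hb.trans_lt (h2 k (hk.trans ha))

theorem mem_ofFinFun {m : ℕ} {g : Fin m → ℕ} (hg : Antitone g) {a b : ℕ} :
    (a, b) ∈ ofFinFun g ↔ ∃ h : a < m, b < g ⟨a, h⟩ := by
  rw [← mem_cells]
  simp only [ofFinFun, mem_filter, mem_biUnion, mem_univ, true_and, mem_image, mem_range,
    Prod.mk.injEq]
  constructor
  · rintro ⟨⟨i, j, hj, rfl, rfl⟩, -⟩
    exact ⟨i.2, hj⟩
  · rintro ⟨h, hb⟩
    exact ⟨⟨⟨a, h⟩, b, hb, rfl, rfl⟩, fun i hi => hb.trans_le (hg (Fin.mk_le_mk.2 hi))⟩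

theorem rowLen_ofFinFun {m : ℕ} {g : Fin m → ℕ} (hg : Antitone g) (i : Fin m) :
    (ofFinFun g).rowLen i = g i := by
  refine eq_of_forall_lt_iff fun b => ?_
  rw [← mem_iff_lt_rowLen, mem_ofFinFun hg]
  simp

theorem rowLen_ofFinFun_last {m : ℕ} {g : Fin m → ℕ} (hg : Antitone g) :
    (ofFinFun g).rowLen m = 0 := by
  by_contra h
  have := mem_iff_lt_rowLen.2 (Nat.pos_of_ne_zero h)
  rw [mem_ofFinFun hg] at this
  exact lt_irrefl _ this.1

theorem ofFinFun_rowLen {m : ℕ} {μ : YoungDiagram} (h : μ.rowLen m = 0) :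
    ofFinFun (fun i : Fin m => μ.rowLen i) = μ :=
  ext_rowLen_of_lt (rowLen_ofFinFun_last (μ.antitone_rowLen_fin m)) h fun i hi =>
    rowLen_ofFinFun (μ.antitone_rowLen_fin m) ⟨i, hi⟩

end YoungDiagram

namespace SemistandardYoungTableau

open Finset

variable {μ ν : YoungDiagram}

theorem finite_setOf_entry_lt (n : ℕ) (μ : YoungDiagram) :
    {T : SemistandardYoungTableau μ | ∀ c ∈ μ.cells, T c.1 c.2 < n}.Finite := by
  rw [← Set.finite_coe_iff]
  refine Finite.of_injective (β := μ.cells → Fin n)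
    (fun T c => ⟨T.1 c.1.1 c.1.2, T.2 c.1 c.2⟩) fun T T' h => Subtype.ext (ext fun i j => ?_)
  by_cases hc : (i, j) ∈ μ
  · exact congrArg Fin.val (congrFun h ⟨(i, j), (YoungDiagram.mem_cells _).2 hc⟩)
  · rw [T.1.zeros hc, T'.1.zeros hc]

/-- The semistandard Young tableaux of shape `μ` with entries less than `n`. -/
noncomputable def withEntriesLT (n : ℕ) (μ : YoungDiagram) :
    Finset (SemistandardYoungTableau μ) :=
  (finite_setOf_entry_lt n μ).toFinset

theorem mem_withEntriesLT {n : ℕ} {T : SemistandardYoungTableau μ} :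
    T ∈ withEntriesLT n μ ↔ ∀ i j, (i, j) ∈ μ → T i j < n := by
  simp [withEntriesLT]

/-- The Young diagram formed by the cells with entry less than `n`. -/
def shapeLT (T : SemistandardYoungTableau μ) (n : ℕ) : YoungDiagram where
  cells := μ.cells.filter fun c => T c.1 c.2 < n
  isLowerSet := by
    rintro ⟨a, b⟩ ⟨a', b'⟩ h hc
    obtain ⟨ha, hb⟩ := Prod.mk_le_mk.1 h
    simp only [coe_filter, YoungDiagram.mem_cells, Set.mem_ofPred_eq] at hc ⊢
    refine ⟨μ.up_left_mem ha hb hc.1, lt_of_le_of_lt ?_ hc.2⟩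
    exact (T.row_weak_of_le hb (μ.up_left_mem ha le_rfl hc.1)).trans (T.col_weak ha hc.1)

theorem mem_shapeLT {T : SemistandardYoungTableau μ} {n i j : ℕ} :
    (i, j) ∈ T.shapeLT n ↔ (i, j) ∈ μ ∧ T i j < n := by
  rw [← YoungDiagram.mem_cells]
  simp [shapeLT]

/-- The restriction of a tableau to a smaller shape. -/
def restrict (T : SemistandardYoungTableau μ) (h : ν ≤ μ) : SemistandardYoungTableau ν where
  entry i j := if (i, j) ∈ ν then T i j else 0
  row_weak' hj hc := by
    rw [if_pos hc, if_pos (ν.up_left_mem le_rfl hj.le hc)]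
    exact T.row_weak hj (h hc)
  col_strict' hi hc := by
    rw [if_pos hc, if_pos (ν.up_left_mem hi.le le_rfl hc)]
    exact T.col_strict hi (h hc)
  zeros' hc := if_neg hc

theorem restrict_apply (T : SemistandardYoungTableau μ) (h : ν ≤ μ) (i j : ℕ) :
    T.restrict h i j = if (i, j) ∈ ν then T i j else 0 :=
  rfl

/-- The extension of a tableau with entries less than `n` by a horizontal strip filled with `n`. -/
def extend {n : ℕ} (T : SemistandardYoungTableau ν) (hT : ∀ i j, (i, j) ∈ ν → T i j < n)
    (h : ν ≤ μ ∧ ∀ i j, (i + 1, j) ∈ μ → (i, j) ∈ ν) : SemistandardYoungTableau μ where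
  entry i j := if (i, j) ∈ ν then T i j else if (i, j) ∈ μ then n else 0
  row_weak' {i j1 j2} hj hc := by
    have hc' := μ.up_left_mem le_rfl hj.le hc
    by_cases h2 : (i, j2) ∈ ν
    · rw [if_pos h2, if_pos (ν.up_left_mem le_rfl hj.le h2)]
      exact T.row_weak hj h2
    · rw [if_neg h2, if_pos hc]
      split_ifs with h1
      · exact (hT _ _ h1).le
      · exact le_rfl
  col_strict' {i1 i2 j} hi hc := by
    have h1 : (i1, j) ∈ ν := h.2 i1 j (μ.up_left_mem hi le_rfl hc)
    rw [if_pos h1]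
    split_ifs with h2
    · exact T.col_strict hi h2
    · exact hT _ _ h1
  zeros' hc := by rw [if_neg fun hn => hc (h.1 hn), if_neg hc]

theorem extend_apply {n : ℕ} (T : SemistandardYoungTableau ν)
    (hT : ∀ i j, (i, j) ∈ ν → T i j < n) (h : ν ≤ μ ∧ ∀ i j, (i + 1, j) ∈ μ → (i, j) ∈ ν)
    (i j : ℕ) : T.extend hT h i j = if (i, j) ∈ ν then T i j else if (i, j) ∈ μ then n else 0 :=
  rfl

section TableauSum

variable {R : Type*} [CommRing R]

/-- The generating function of semistandard Young tableaux of shape `μ` with entries less than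
`n`, evaluated at `x`. -/
noncomputable def tableauSum (x : ℕ → R) (n : ℕ) (μ : YoungDiagram) : R :=
  ∑ T ∈ withEntriesLT n μ, ∏ c ∈ μ.cells, x (T c.1 c.2)

theorem tableauSum_zero_bot (x : ℕ → R) : tableauSum x 0 ⊥ = 1 := by
  have : withEntriesLT 0 ⊥ = {highestWeight ⊥} := by
    ext T
    simp only [mem_withEntriesLT, mem_singleton, YoungDiagram.notMem_bot, false_imp_iff,
      implies_true, true_iff]
    ext i j
    rw [T.zeros (YoungDiagram.notMem_bot _), zeros _ (YoungDiagram.notMem_bot _)]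
  simp [tableauSum, this]

theorem tableauSum_zero_of_ne_bot (x : ℕ → R) (h : μ ≠ ⊥) : tableauSum x 0 μ = 0 := by
  have : withEntriesLT 0 μ = ∅ := by
    refine eq_empty_of_forall_notMem fun T hT => h ?_
    refine SetLike.ext fun ⟨i, j⟩ => iff_of_false (fun hc => ?_) (YoungDiagram.notMem_bot _)
    exact absurd (mem_withEntriesLT.1 hT i j hc) (Nat.not_lt_zero _)
  simp [tableauSum, this]

theorem tableauSum_succ (x : ℕ → R) (n : ℕ) (μ : YoungDiagram) :
    tableauSum x (n + 1) μ =
      ∑ ν ∈ μ.removeHorizontalStrip, tableauSum x n ν * x n ^ (μ.card - ν.card) := by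
  classical
  rw [tableauSum, ← sum_fiberwise_of_maps_to (g := fun T => T.shapeLT n)
    (t := μ.removeHorizontalStrip)]
  · refine sum_congr rfl fun ν hν => ?_
    rw [YoungDiagram.mem_removeHorizontalStrip] at hν
    rw [tableauSum, sum_mul]
    have hmem : ∀ T : SemistandardYoungTableau μ, T.shapeLT n = ν →
        ∀ i j, (i, j) ∈ ν → T i j < n := by
      rintro T rfl i j h
      exact (mem_shapeLT.1 h).2
    have hnot : ∀ T : SemistandardYoungTableau μ, T ∈ withEntriesLT (n + 1) μ → T.shapeLT n = ν →
        ∀ i j, (i, j) ∈ μ → (i, j) ∉ ν → T i j = n := by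
      rintro T hT rfl i j h h'
      have := mem_withEntriesLT.1 hT i j h
      have : ¬ T i j < n := fun hlt => h' (mem_shapeLT.2 ⟨h, hlt⟩)
      omega
    refine sum_bij' (fun T _ => T.restrict hν.1)
      (fun T hT => T.extend (mem_withEntriesLT.1 hT) hν) ?_ ?_ ?_ ?_ ?_
    · intro T hT
      rw [mem_filter] at hT
      rw [mem_withEntriesLT]
      intro i j h
      rw [restrict_apply, if_pos h]
      exact hmem T hT.2 i j h
    · intro T hT
      have hT' := mem_withEntriesLT.1 hT
      rw [mem_filter, mem_withEntriesLT]
      refine ⟨fun i j h => ?_, SetLike.ext ?_⟩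
      · rw [extend_apply]
        split_ifs with h1
        · exact (hT' i j h1).trans (Nat.lt_succ_self n)
        · exact Nat.lt_succ_self n
      · rintro ⟨i, j⟩
        rw [mem_shapeLT, extend_apply]
        constructor
        · rintro ⟨h1, h2⟩
          by_contra h3
          rw [if_neg h3, if_pos h1] at h2
          exact lt_irrefl _ h2
        · intro h
          rw [if_pos h]
          exact ⟨hν.1 h, hT' i j h⟩
    · intro T hT
      rw [mem_filter] at hT
      ext i j
      rw [extend_apply, restrict_apply]
      split_ifs with h1 h2
      · rfl
      · exact (hnot T hT.1 hT.2 i j h2 h1).symm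
      · exact (T.zeros h2).symm
    · intro T hT
      ext i j
      rw [restrict_apply, extend_apply]
      split_ifs with h1
      · rfl
      · exact (T.zeros h1).symm
    · intro T hT
      rw [mem_filter] at hT
      have hsub := YoungDiagram.cells_subset_iff.2 hν.1
      rw [← prod_sdiff hsub, mul_comm, YoungDiagram.card, YoungDiagram.card,
        ← card_sdiff_of_subset hsub, ← prod_const]
      congr 1
      · refine prod_congr rfl fun c hc => ?_
        rw [restrict_apply, if_pos ((YoungDiagram.mem_cells _).1 hc)]
      · refine prod_congr rfl fun c hc => ?_
        rw [mem_sdiff, YoungDiagram.mem_cells, YoungDiagram.mem_cells] at hc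
        rw [hnot T hT.1 hT.2 c.1 c.2 hc.1 hc.2]
  · intro T hT
    rw [YoungDiagram.mem_removeHorizontalStrip]
    refine ⟨fun c hc => (mem_shapeLT.1 hc).1, fun i j h => mem_shapeLT.2 ?_⟩
    have h1 := mem_withEntriesLT.1 hT _ _ h
    have h2 := T.col_strict (Nat.lt_add_one i) h
    exact ⟨μ.up_left_mem (Nat.le_succ i) le_rfl h, by omega⟩

theorem tableauSum_eq_zero (x : ℕ → R) {m : ℕ} (h : μ.rowLen m ≠ 0) : tableauSum x m μ = 0 := by
  induction m generalizing μ with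
  | zero =>
    refine tableauSum_zero_of_ne_bot x fun h0 => YoungDiagram.notMem_bot (0, 0) ?_
    rw [← h0, YoungDiagram.mem_iff_lt_rowLen]
    exact Nat.pos_of_ne_zero h
  | succ m ih =>
    rw [tableauSum_succ]
    refine sum_eq_zero fun ν hν => ?_
    have := (YoungDiagram.mem_removeHorizontalStrip_iff_rowLen.1 hν m).2
    rw [ih (by omega), zero_mul]

theorem tableauSum_eq_gelfandTsetlinSum (x : ℕ → R) {m : ℕ} (h : μ.rowLen m = 0) :
    tableauSum x m μ = gelfandTsetlinSum x m fun i => μ.rowLen i := by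
  induction m generalizing μ with
  | zero =>
    have : μ = ⊥ := YoungDiagram.ext_rowLen_of_lt h
      (Nat.eq_zero_of_not_pos fun hp =>
        YoungDiagram.notMem_bot (0, 0) (YoungDiagram.mem_iff_lt_rowLen.2 hp))
      (by simp)
    rw [this, tableauSum_zero_bot, gelfandTsetlinSum]
  | succ m ih =>
    rw [tableauSum_succ, gelfandTsetlinSum,
      ← sum_filter_of_ne (p := fun ν : YoungDiagram => ν.rowLen m = 0) fun ν _ hne => by
        by_contra h0
        exact hne (by rw [tableauSum_eq_zero x h0, zero_mul])]
    have hanti : ∀ g ∈ Fintype.piFinset fun i : Fin m =>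
        Icc (μ.rowLen i.succ) (μ.rowLen i.castSucc), Antitone g := by
      intro g hg
      simp only [Fintype.mem_piFinset, mem_Icc] at hg
      cases m with
      | zero => exact Subsingleton.antitone g
      | succ m =>
        refine Fin.antitone_iff_succ_le.2 fun i => ?_
        have := (hg i.succ).2
        have := (hg i.castSucc).1
        rw [Fin.succ_castSucc] at this
        omega
    refine sum_bij' (fun ν _ i => ν.rowLen i) (fun g _ => YoungDiagram.ofFinFun g) ?_ ?_ ?_ ?_ ?_
    · intro ν hν
      rw [mem_filter, YoungDiagram.mem_removeHorizontalStrip_iff_rowLen] at hν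
      simp only [Fintype.mem_piFinset, mem_Icc]
      exact fun i => ⟨(hν.1 i).2, (hν.1 i).1⟩
    · intro g hg
      have ha := hanti g hg
      simp only [Fintype.mem_piFinset, mem_Icc] at hg
      rw [mem_filter, YoungDiagram.mem_removeHorizontalStrip_iff_rowLen]
      have h0 := YoungDiagram.rowLen_ofFinFun_last ha
      refine ⟨fun i => ?_, h0⟩
      rcases lt_or_ge i m with hi | hi
      · rw [YoungDiagram.rowLen_ofFinFun ha ⟨i, hi⟩]
        exact ⟨(hg ⟨i, hi⟩).2, (hg ⟨i, hi⟩).1⟩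
      · rw [YoungDiagram.rowLen_eq_zero_of_le h0 hi,
          YoungDiagram.rowLen_eq_zero_of_le h (Nat.succ_le_succ hi)]
        exact ⟨Nat.zero_le _, le_rfl⟩
    · intro ν hν
      exact YoungDiagram.ofFinFun_rowLen (mem_filter.1 hν).2
    · intro g hg
      exact funext fun i => YoungDiagram.rowLen_ofFinFun (hanti g hg) i
    · intro ν hν
      rw [mem_filter, YoungDiagram.mem_removeHorizontalStrip_iff_rowLen] at hν
      rw [ih hν.2, prod_pow_eq_pow_sum, ← pow_add, YoungDiagram.card_eq_sum_rowLen h,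
        YoungDiagram.card_eq_sum_rowLen hν.2, Fin.sum_univ_castSucc]
      have hsub := sum_tsub_distrib (univ : Finset (Fin m)) (f := fun i => μ.rowLen i)
        (g := fun i => ν.rowLen i) fun i _ => (hν.1 (i : ℕ)).1
      have : ∑ i : Fin m, ν.rowLen i ≤ ∑ i : Fin m, μ.rowLen i :=
        sum_le_sum fun i _ => (hν.1 (i : ℕ)).1
      congr 2
      simp only [Fin.val_castSucc, Fin.val_last, hsub]
      omega

theorem tableauSum_transpose_eq_verticalStripSum (x : ℕ → R) (n : ℕ) {m : ℕ}
    (h : μ.rowLen m = 0) :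
    tableauSum x n μ.transpose = verticalStripSum x n fun i : Fin m => μ.rowLen i := by
  classical
  have hbot : ∀ i, (⊥ : YoungDiagram).rowLen i = 0 := fun i =>
    Nat.eq_zero_of_not_pos fun hp =>
      YoungDiagram.notMem_bot (i, 0) (YoungDiagram.mem_iff_lt_rowLen.2 hp)
  have hbt : (⊥ : YoungDiagram).transpose = ⊥ := by
    refine SetLike.ext fun c => ?_
    simp [YoungDiagram.mem_transpose]
  induction n generalizing μ with
  | zero =>
    rw [verticalStripSum]
    by_cases h0 : μ = ⊥
    · subst h0
      rw [hbt, tableauSum_zero_bot, if_pos]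
      exact funext fun i => hbot i
    · rw [tableauSum_zero_of_ne_bot x fun ht => h0
        ((YoungDiagram.transpose_eq_iff_eq_transpose.1 ht).trans hbt), if_neg fun hf => h0 ?_]
      exact YoungDiagram.ext_rowLen_of_lt h (hbot m) fun i hi =>
        (congrFun hf ⟨i, hi⟩).trans (hbot i).symm
  | succ n ih =>
    rw [tableauSum_succ, verticalStripSum]
    have hrow : ∀ ν ∈ μ.transpose.removeHorizontalStrip, ∀ i,
        ν.transpose.rowLen i ≤ μ.rowLen i ∧ μ.rowLen i - 1 ≤ ν.transpose.rowLen i := by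
      intro ν hν
      rw [← ν.transpose_transpose] at hν
      exact YoungDiagram.transpose_mem_removeHorizontalStrip_iff_rowLen.1 hν
    have hlast : ∀ ν ∈ μ.transpose.removeHorizontalStrip, ν.transpose.rowLen m = 0 := by
      intro ν hν
      have := (hrow ν hν m).1
      omega
    refine sum_bij' (fun ν _ i => ν.transpose.rowLen i)
      (fun g _ => (YoungDiagram.ofFinFun g).transpose) ?_ ?_ ?_ ?_ ?_
    · intro ν hν
      simp only [mem_filter, Fintype.mem_piFinset, mem_Icc]
      exact ⟨fun i => (hrow ν hν i).symm, YoungDiagram.antitone_rowLen_fin _ m⟩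
    · intro g hg
      simp only [mem_filter, Fintype.mem_piFinset, mem_Icc] at hg
      rw [YoungDiagram.transpose_mem_removeHorizontalStrip_iff_rowLen]
      intro i
      rcases lt_or_ge i m with hi | hi
      · rw [YoungDiagram.rowLen_ofFinFun hg.2 ⟨i, hi⟩]
        exact (hg.1 ⟨i, hi⟩).symm
      · rw [YoungDiagram.rowLen_eq_zero_of_le (YoungDiagram.rowLen_ofFinFun_last hg.2) hi,
          YoungDiagram.rowLen_eq_zero_of_le h hi]
        exact ⟨le_rfl, Nat.zero_le _⟩
    · intro ν hν
      rw [YoungDiagram.ofFinFun_rowLen (hlast ν hν), YoungDiagram.transpose_transpose]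
    · intro g hg
      funext i
      rw [YoungDiagram.transpose_transpose]
      exact YoungDiagram.rowLen_ofFinFun (mem_filter.1 hg).2 i
    · intro ν hν
      have hsub := sum_tsub_distrib (univ : Finset (Fin m)) (f := fun i => μ.rowLen i)
        (g := fun i => ν.transpose.rowLen i) fun i _ => (hrow ν hν i).1
      rw [← ih (hlast ν hν), YoungDiagram.transpose_transpose, prod_pow_eq_pow_sum, hsub,
        ← YoungDiagram.card_eq_sum_rowLen h,
        ← YoungDiagram.card_eq_sum_rowLen (hlast ν hν), YoungDiagram.card_transpose,
        YoungDiagram.card_transpose]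

end TableauSum

section MvPolynomial

open MvPolynomial

theorem isHomogeneous_tableauSum {σ : Type*} {x : ℕ → MvPolynomial σ ℤ}
    (hx : ∀ i, (x i).IsHomogeneous 1) (n : ℕ) (μ : YoungDiagram) :
    (tableauSum x n μ).IsHomogeneous μ.card := by
  refine IsHomogeneous.sum _ _ _ fun T _ => ?_
  have := IsHomogeneous.prod μ.cells (fun c => x (T c.1 c.2)) (fun _ => 1) fun c _ => hx _
  simpa using this

theorem rename_schurPoly {σ : Type*} {n : ℕ} (k : Fin n → σ) (μ : YoungDiagram) :
    rename k (schurPoly n μ) =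
      tableauSum (fun i => if h : i < n then X (k ⟨i, h⟩) else 0) n μ := by
  have hs : schurPoly n μ = ∑ T ∈ withEntriesLT n μ,
      ∏ i : Fin n, (X i : MvPolynomial (Fin n) ℤ) ^ ssytWeight T (i : ℕ) :=
    finsum_mem_eq_finite_toFinset_sum _ (finite_setOf_entry_lt n μ)
  rw [hs, map_sum, tableauSum]
  refine sum_congr rfl fun T hT => ?_
  rw [mem_withEntriesLT] at hT
  simp only [map_prod, map_pow, rename_X]
  rw [← prod_fiberwise_of_maps_to (s := μ.cells) (t := range n) (g := fun c => T c.1 c.2)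
    fun c hc => mem_range.2 (hT c.1 c.2 ((YoungDiagram.mem_cells _).1 hc)), prod_range]
  refine prod_congr rfl fun i _ => ?_
  rw [ssytWeight, ← prod_const]
  refine prod_congr rfl fun c hc => ?_
  rw [(mem_filter.1 hc).2, dif_pos i.2]

end MvPolynomial

end SemistandardYoungTableau

open Finset in
theorem prod_prod_one_add_eq_sum_matrix {R : Type*} [CommRing R] {n m : ℕ}
    (a : Fin n → Fin m → R) :
    ∏ i, ∏ j, (1 + a i j) =
      ∑ A ∈ (Fintype.piFinset fun _ : Fin n => Fintype.piFinset fun _ : Fin m => range 2),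
        ∏ i, ∏ j, a i j ^ A i j := by
  have h : ∀ i j, 1 + a i j = ∑ e ∈ range 2, a i j ^ e := fun i j => by
    simp [sum_range_succ]
  simp_rw [h]
  simp_rw [prod_univ_sum (t := fun _ : Fin m => range 2) (f := fun j e => a _ j ^ e)]
  exact prod_univ_sum (t := fun _ : Fin n => Fintype.piFinset fun _ : Fin m => range 2)
    (f := fun i (r : Fin m → ℕ) => ∏ j, a i j ^ r j)

theorem MvPolynomial.homogeneousComponent_of_isHomogeneous {σ R : Type*} [CommSemiring R]
    {p : MvPolynomial σ R} {k : ℕ} (h : p.IsHomogeneous k) (l : ℕ) :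
    homogeneousComponent l p = if l = k then p else 0 :=
  homogeneousComponent_of_mem h

open MvPolynomial in
/-- **Dual Cauchy identity / skew (GL_n, GL_m)-duality on characters.**
`∑_{λ ⊢ d} s_{λ'}(x) s_λ(y)` equals the elementary symmetric polynomial of degree `d` in the
`n·m` variables `x_i y_j`, i.e. the sum over `n × m` matrices `A` with entries in `{0,1}` and
total sum `d` of `∏_{i,j} (x_i y_j)^{A i j}`. -/
theorem skew_gl_gl_duality_characters (m n d : ℕ) (hm : 0 < m) (hn : 0 < n) :
    ∑ᶠ (lam : YoungDiagram) (_ : lam.card = d),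
        (rename Sum.inl (schurPoly n lam.transpose) : MvPolynomial (Fin n ⊕ Fin m) ℤ) *
          rename Sum.inr (schurPoly m lam) =
      ∑ᶠ (A : Matrix (Fin n) (Fin m) ℕ) (_ : (∀ i j, A i j ≤ 1) ∧ ∑ i, ∑ j, A i j = d),
        ∏ i : Fin n, ∏ j : Fin m,
          ((X (Sum.inl i) : MvPolynomial (Fin n ⊕ Fin m) ℤ) * X (Sum.inr j)) ^ A i j := by
  classical
  set x : ℕ → MvPolynomial (Fin n ⊕ Fin m) ℤ :=
    fun i => if h : i < n then X (Sum.inl ⟨i, h⟩) else 0 with hx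
  set y : ℕ → MvPolynomial (Fin n ⊕ Fin m) ℤ :=
    fun j => if h : j < m then X (Sum.inr ⟨j, h⟩) else 0 with hy
  have hx1 : ∀ i, (x i).IsHomogeneous 1 := fun i => by
    simp only [hx]
    split_ifs
    · exact isHomogeneous_X _ _
    · exact isHomogeneous_zero _ _ _
  have hy1 : ∀ i, (y i).IsHomogeneous 1 := fun i => by
    simp only [hy]
    split_ifs
    · exact isHomogeneous_X _ _
    · exact isHomogeneous_zero _ _ _
  set t : YoungDiagram → MvPolynomial (Fin n ⊕ Fin m) ℤ := fun lam =>
    SemistandardYoungTableau.tableauSum x n lam.transpose *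
      SemistandardYoungTableau.tableauSum y m lam with ht
  have htd : ∀ lam : YoungDiagram, (t lam).IsHomogeneous (lam.card + lam.card) := fun lam => by
    have := SemistandardYoungTableau.isHomogeneous_tableauSum hx1 n lam.transpose
    rw [YoungDiagram.card_transpose] at this
    exact this.mul (SemistandardYoungTableau.isHomogeneous_tableauSum hy1 m lam)
  set S := (Fintype.piFinset fun _ : Fin m => Finset.range (n + 1)).filter Antitone with hS
  have hSanti : ∀ f ∈ S, Antitone f := fun f hf => (Finset.mem_filter.1 hf).2
  have key : ∑ f ∈ S, t (YoungDiagram.ofFinFun f) = ∑ A ∈ (Fintype.piFinset fun _ : Fin n =>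
      Fintype.piFinset fun _ : Fin m => Finset.range 2),
      ∏ i : Fin n, ∏ j : Fin m, ((X (Sum.inl i) : MvPolynomial (Fin n ⊕ Fin m) ℤ) *
        X (Sum.inr j)) ^ A i j := by
    rw [← prod_prod_one_add_eq_sum_matrix]
    have := sum_verticalStripSum_mul_gelfandTsetlinSum x y m (le_refl n)
    rw [Finset.prod_range] at this
    simp only [Finset.prod_range] at this
    have hxi : ∀ i : Fin n, x i = X (Sum.inl i) := fun i => by simp [hx]
    have hyj : ∀ j : Fin m, y j = X (Sum.inr j) := fun j => by simp [hy]
    simp only [hxi, hyj] at this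
    rw [← this]
    refine Finset.sum_congr rfl fun f hf => ?_
    have hl := YoungDiagram.rowLen_ofFinFun_last (hSanti f hf)
    have hr : (fun i : Fin m => (YoungDiagram.ofFinFun f).rowLen i) = f :=
      funext (YoungDiagram.rowLen_ofFinFun (hSanti f hf))
    simp only [ht]
    rw [SemistandardYoungTableau.tableauSum_eq_gelfandTsetlinSum y hl,
      SemistandardYoungTableau.tableauSum_transpose_eq_verticalStripSum x n hl, hr]
  have hcomp := congrArg (homogeneousComponent (d + d)) key
  rw [map_sum, map_sum] at hcomp
  have hdd : ∀ k : ℕ, d + d = k + k ↔ k = d := fun k => by omega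
  simp only [homogeneousComponent_of_isHomogeneous (htd _), hdd] at hcomp
  have hA : ∀ A : Fin n → Fin m → ℕ, (∏ i : Fin n, ∏ j : Fin m,
      ((X (Sum.inl i) : MvPolynomial (Fin n ⊕ Fin m) ℤ) * X (Sum.inr j)) ^ A i j).IsHomogeneous
      (∑ i, ∑ j, A i j + ∑ i, ∑ j, A i j) := fun A => by
    rw [← two_mul, Finset.mul_sum]
    refine IsHomogeneous.prod _ _ _ fun i _ => ?_
    rw [Finset.mul_sum]
    refine IsHomogeneous.prod _ _ _ fun j _ => ?_
    exact ((isHomogeneous_X _ _).mul (isHomogeneous_X _ _)).pow _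
  simp only [homogeneousComponent_of_isHomogeneous (hA _), hdd] at hcomp
  have hinj : Set.InjOn (YoungDiagram.ofFinFun (m := m)) S := fun f hf g hg h => by
    funext i
    rw [← YoungDiagram.rowLen_ofFinFun (hSanti f hf) i, h,
      YoungDiagram.rowLen_ofFinFun (hSanti g hg) i]
  simp only [SemistandardYoungTableau.rename_schurPoly]
  change ∑ᶠ (lam : YoungDiagram) (_ : lam.card = d), t lam = _
  simp only [finsum_eq_if]
  rw [finsum_eq_sum_of_support_subset (s := S.image YoungDiagram.ofFinFun),
    Finset.sum_image hinj, hcomp]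
  · refine Eq.trans ?_ (finsum_eq_sum_of_support_subset (α := Fin n → Fin m → ℕ) _ (s :=
      Fintype.piFinset fun _ : Fin n => Fintype.piFinset fun _ : Fin m => Finset.range 2) ?_).symm
    · refine Finset.sum_congr rfl fun A hA => ?_
      simp only [Fintype.mem_piFinset, Finset.mem_range] at hA
      have : ∀ i j, A i j ≤ 1 := fun i j => Nat.lt_succ_iff.1 (hA i j)
      simp only [this, implies_true, true_and]
    · intro A hA
      have h01 : ∀ i j, A i j ≤ 1 := by
        by_contra h
        exact hA (if_neg fun h' => h h'.1)
      simp only [Finset.mem_coe, Fintype.mem_piFinset, Finset.mem_range]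
      exact fun i j => Nat.lt_succ_iff.2 (h01 i j)
  · intro lam hlam
    rw [Function.mem_support, ne_eq, ite_eq_right_iff, Classical.not_imp] at hlam
    have h1 : lam.rowLen m = 0 := by
      by_contra h0
      exact right_ne_zero_of_mul hlam.2 (SemistandardYoungTableau.tableauSum_eq_zero y h0)
    have h2 := left_ne_zero_of_mul hlam.2
    rw [SemistandardYoungTableau.tableauSum_transpose_eq_verticalStripSum x n h1] at h2
    rw [Finset.mem_coe, Finset.mem_image]
    refine ⟨fun i => lam.rowLen i, ?_, YoungDiagram.ofFinFun_rowLen h1⟩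
    simp only [hS, Finset.mem_filter, Fintype.mem_piFinset, Finset.mem_range]
    exact ⟨fun i => Nat.lt_succ_iff.2 (le_of_verticalStripSum_ne_zero h2 i),
      lam.antitone_rowLen_fin m⟩
end

section
/- For every positive integer n and every nonnegative integer l, the complete homogeneous symmetric polynomial of degree l in the binomial(n,2) variables {x_i x_j : 1 ≤ i < j ≤ n} equals the sum of the Schur polynomials s_λ(x_1,…,x_n) over all partitions λ of 2l in which every part appears an even number of times (equivalently, all parts of the conjugate partition λ' are even). -/
/-- The shape obtained by deleting the first row. -/
noncomputable def shapeTail (f : ℕ →₀ ℕ) : ℕ →₀ ℕ :=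
  f.comapDomain Nat.succ Nat.succ_injective.injOn

/-- The shape obtained by adding a first row of length `a`. -/
noncomputable def shapeCons (a : ℕ) (f : ℕ →₀ ℕ) : ℕ →₀ ℕ :=
  Finsupp.single 0 a + f.mapDomain Nat.succ

@[simp]
theorem shapeTail_apply (f : ℕ →₀ ℕ) (i : ℕ) : shapeTail f i = f (i + 1) := rfl

@[simp]
theorem shapeCons_zero (a : ℕ) (f : ℕ →₀ ℕ) : shapeCons a f 0 = a := by
  rw [shapeCons, Finsupp.add_apply, Finsupp.mapDomain_of_notMem_range]
  · simp
  · simp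

@[simp]
theorem shapeCons_succ (a : ℕ) (f : ℕ →₀ ℕ) (i : ℕ) : shapeCons a f (i + 1) = f i := by
  rw [shapeCons, Finsupp.add_apply]
  have := Finsupp.mapDomain_apply Nat.succ_injective f i
  rw [Nat.succ_eq_add_one] at this
  rw [this]
  simp

@[simp]
theorem shapeTail_shapeCons (a : ℕ) (f : ℕ →₀ ℕ) : shapeTail (shapeCons a f) = f := by
  ext i; simp

theorem shapeCons_shapeTail (f : ℕ →₀ ℕ) : shapeCons (f 0) (shapeTail f) = f := by
  ext i; cases i <;> simp

@[simp]
theorem degree_shapeCons (a : ℕ) (f : ℕ →₀ ℕ) : (shapeCons a f).degree = a + f.degree := by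
  simp [shapeCons, map_add, Finsupp.degree_mapDomain]

theorem degree_eq_add_shapeTail (f : ℕ →₀ ℕ) : f.degree = f 0 + (shapeTail f).degree := by
  conv_lhs => rw [← shapeCons_shapeTail f, degree_shapeCons]

/-- The shapes `μ` such that `f / μ` is a horizontal strip. -/
noncomputable def lowerStrips (f : ℕ →₀ ℕ) : Finset (ℕ →₀ ℕ) :=
  Finset.Icc (shapeTail f) f

/-- The shapes `g` such that `g / f` is a horizontal strip of size `k`. -/
noncomputable def upperStrips (f : ℕ →₀ ℕ) (k : ℕ) : Finset (ℕ →₀ ℕ) :=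
  (Finset.Icc f (shapeCons (f 0 + k) f)).filter fun g => shapeTail g ≤ f ∧ g.degree = f.degree + k

theorem mem_lowerStrips {f g : ℕ →₀ ℕ} : g ∈ lowerStrips f ↔ shapeTail f ≤ g ∧ g ≤ f :=
  Finset.mem_Icc

theorem mem_upperStrips {f g : ℕ →₀ ℕ} {k : ℕ} :
    g ∈ upperStrips f k ↔ shapeTail g ≤ f ∧ f ≤ g ∧ g.degree = f.degree + k := by
  simp only [upperStrips, Finset.mem_filter, Finset.mem_Icc]
  refine ⟨fun h => ⟨h.2.1, h.1.1, h.2.2⟩, fun ⟨h1, h2, h3⟩ => ⟨⟨h2, fun i => ?_⟩, h1, h3⟩⟩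
  cases i with
  | zero =>
    have h4 : shapeTail f ≤ shapeTail g := fun i => h2 (i + 1)
    have h5 := Finsupp.degree_mono h4
    rw [degree_eq_add_shapeTail f, degree_eq_add_shapeTail g] at h3
    simp only [shapeCons_zero]
    omega
  | succ i => simpa using h1 i

theorem degree_toggle {f g h k : ℕ →₀ ℕ} (h0 : g 0 = max (f 0) (h 0))
    (hk : k + shapeTail g = shapeTail (f ⊔ h) + f ⊓ h) :
    k.degree + g.degree = f.degree + h.degree := by
  have h1 := congrArg Finsupp.degree hk
  have h2 : f.degree + h.degree = (f ⊔ h).degree + (f ⊓ h).degree := by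
    rw [← map_add, ← map_add]
    congr 1
    ext i
    simp only [Finsupp.add_apply, Finsupp.sup_apply, Finsupp.inf_apply]
    omega
  rw [map_add, map_add] at h1
  rw [degree_eq_add_shapeTail g, h2, degree_eq_add_shapeTail (f ⊔ h), Finsupp.sup_apply, h0]
  omega

section Commutation

variable {R : Type*} [CommRing R] (s : (ℕ →₀ ℕ) → R) (x : R)

theorem sum_upper_lower_toggle (f : ℕ →₀ ℕ) (k : ℕ) :
    ∑ p ∈ ((upperStrips f k).sigma fun g => lowerStrips g) with p.1 0 = max (f 0) (p.2 0),
        s p.2 * x ^ (p.1.degree - p.2.degree) =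
      ∑ p ∈ (lowerStrips f).sigma fun g => upperStrips g k,
        s p.2 * x ^ (f.degree - p.1.degree) := by
  refine Finset.sum_bij'
    (fun p _ => ⟨shapeTail (f ⊔ p.2) + f ⊓ p.2 - shapeTail p.1, p.2⟩)
    (fun p _ => ⟨shapeCons (max (f 0) (p.2 0)) (shapeTail (f ⊔ p.2) + f ⊓ p.2 - p.1), p.2⟩)
    ?_ ?_ ?_ ?_ ?_
  · rintro ⟨g, h⟩ hp
    simp only [Finset.mem_filter, Finset.mem_sigma, mem_upperStrips, mem_lowerStrips] at hp ⊢
    obtain ⟨⟨⟨h1, h2, h3⟩, h4, h5⟩, h0⟩ := hp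
    have hd : (shapeTail (f ⊔ h) + f ⊓ h - shapeTail g).degree + g.degree = f.degree + h.degree := by
      refine degree_toggle h0 ?_
      ext i
      have := h1 i; have := h4 i; have := h2 (i + 1); have := h5 (i + 1)
      simp at *
      omega
    refine ⟨⟨fun i => ?_, fun i => ?_⟩, fun i => ?_, fun i => ?_, by omega⟩ <;>
    · have := h1 i; have := h4 i; have := h2 (i + 1); have := h5 (i + 1)
      simp at *
      omega
  · rintro ⟨g, h⟩ hp
    simp only [Finset.mem_filter, Finset.mem_sigma, mem_upperStrips, mem_lowerStrips] at hp ⊢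
    obtain ⟨⟨h1, h2⟩, h3, h4, h5⟩ := hp
    have hd := degree_toggle (f := f) (h := h) (k := g)
      (g := shapeCons (max (f 0) (h 0)) (shapeTail (f ⊔ h) + f ⊓ h - g)) (by simp) (by
        ext i
        have := h1 i; have := h3 i; have := h2 i; have := h4 i
        simp at *
        omega)
    refine ⟨⟨⟨fun i => ?_, fun i => ?_, by omega⟩, fun i => ?_, fun i => ?_⟩, by simp⟩
    · have := h1 i; have := h3 i; have := h2 i; have := h4 i
      simp at *
      omega
    · cases i with
      | zero => simp
      | succ i =>
        have := h1 i; have := h3 i; have := h2 i; have := h4 i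
        simp at *
        omega
    · have := h1 i; have := h3 i; have := h2 i; have := h4 i
      simp at *
      omega
    · cases i with
      | zero => simp
      | succ i =>
        have := h1 i; have := h3 i; have := h2 i; have := h4 i
        simp at *
        omega
  · rintro ⟨g, h⟩ hp
    simp only [Finset.mem_filter, Finset.mem_sigma, mem_upperStrips, mem_lowerStrips] at hp
    obtain ⟨⟨⟨h1, h2, h3⟩, h4, h5⟩, h0⟩ := hp
    simp only [Sigma.mk.injEq, heq_eq_eq, and_true]
    ext i
    cases i with
    | zero => simp [h0]
    | succ i =>
      have := h1 i; have := h4 i; have := h2 (i + 1); have := h5 (i + 1)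
      simp at *
      omega
  · rintro ⟨g, h⟩ hp
    simp only [Finset.mem_sigma, mem_upperStrips, mem_lowerStrips] at hp
    obtain ⟨⟨h1, h2⟩, h3, h4, h5⟩ := hp
    simp only [Sigma.mk.injEq, heq_eq_eq, and_true]
    ext i
    have := h1 i; have := h3 i; have := h2 i; have := h4 i
    simp at *
    omega
  · rintro ⟨g, h⟩ hp
    simp only [Finset.mem_filter, Finset.mem_sigma, mem_upperStrips, mem_lowerStrips] at hp ⊢
    obtain ⟨⟨⟨h1, h2, h3⟩, h4, h5⟩, h0⟩ := hp
    have hd : (shapeTail (f ⊔ h) + f ⊓ h - shapeTail g).degree + g.degree = f.degree + h.degree := by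
      refine degree_toggle h0 ?_
      ext i
      have := h1 i; have := h4 i; have := h2 (i + 1); have := h5 (i + 1)
      simp at *
      omega
    congr 2
    have := Finsupp.degree_mono h5
    omega

theorem sum_upper_lower_shorten (f : ℕ →₀ ℕ) (k : ℕ) :
    ∑ p ∈ ((upperStrips f (k + 1)).sigma fun g => lowerStrips g) with
        ¬ p.1 0 = max (f 0) (p.2 0), s p.2 * x ^ (p.1.degree - p.2.degree) =
      x * ∑ p ∈ (upperStrips f k).sigma fun g => lowerStrips g,
        s p.2 * x ^ (p.1.degree - p.2.degree) := by
  rw [Finset.mul_sum]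
  refine Finset.sum_bij'
    (fun p _ => ⟨shapeCons (p.1 0 - 1) (shapeTail p.1), p.2⟩)
    (fun p _ => ⟨shapeCons (p.1 0 + 1) (shapeTail p.1), p.2⟩)
    ?_ ?_ ?_ ?_ ?_
  · rintro ⟨g, h⟩ hp
    simp only [Finset.mem_filter, Finset.mem_sigma, mem_upperStrips, mem_lowerStrips] at hp ⊢
    obtain ⟨⟨⟨h1, h2, h3⟩, h4, h5⟩, h0⟩ := hp
    have hf0 := h2 0
    have hh0 := h5 0
    rw [degree_eq_add_shapeTail g] at h3
    refine ⟨⟨by simpa using h1, fun i => ?_, by rw [degree_shapeCons]; omega⟩, by simpa using h4,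
      fun i => ?_⟩
    · cases i with
      | zero => simp; omega
      | succ i => simpa using h2 (i + 1)
    · cases i with
      | zero => simp; omega
      | succ i => simpa using h5 (i + 1)
  · rintro ⟨g, h⟩ hp
    simp only [Finset.mem_filter, Finset.mem_sigma, mem_upperStrips, mem_lowerStrips] at hp ⊢
    obtain ⟨⟨h1, h2, h3⟩, h4, h5⟩ := hp
    have hf0 := h2 0
    have hh0 := h5 0
    rw [degree_eq_add_shapeTail g] at h3
    refine ⟨⟨⟨by simpa using h1, fun i => ?_, by rw [degree_shapeCons]; omega⟩, by simpa using h4,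
      fun i => ?_⟩, by simp; omega⟩
    · cases i with
      | zero => simp; omega
      | succ i => simpa using h2 (i + 1)
    · cases i with
      | zero => simp; omega
      | succ i => simpa using h5 (i + 1)
  · rintro ⟨g, h⟩ hp
    simp only [Finset.mem_filter, Finset.mem_sigma, mem_upperStrips, mem_lowerStrips] at hp
    obtain ⟨⟨⟨h1, h2, h3⟩, h4, h5⟩, h0⟩ := hp
    have hf0 := h2 0
    have hh0 := h5 0
    simp only [Sigma.mk.injEq, heq_eq_eq, and_true, shapeCons_zero, shapeTail_shapeCons]
    rw [Nat.sub_add_cancel (by omega), shapeCons_shapeTail]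
  · rintro ⟨g, h⟩ hp
    simp only [Sigma.mk.injEq, heq_eq_eq, and_true, shapeCons_zero, shapeTail_shapeCons]
    rw [Nat.add_sub_cancel, shapeCons_shapeTail]
  · rintro ⟨g, h⟩ hp
    simp only [Finset.mem_filter, Finset.mem_sigma, mem_upperStrips, mem_lowerStrips] at hp
    obtain ⟨⟨⟨h1, h2, h3⟩, h4, h5⟩, h0⟩ := hp
    have hf0 := h2 0
    have hh0 := h5 0
    have hd : h.degree ≤ (shapeCons (g 0 - 1) (shapeTail g)).degree := by
      refine Finsupp.degree_mono fun i => ?_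
      cases i with
      | zero => simp; omega
      | succ i => simpa using h5 (i + 1)
    rw [degree_shapeCons] at hd
    rw [mul_left_comm, ← pow_succ', degree_shapeCons, degree_eq_add_shapeTail g]
    congr 2
    dsimp only
    omega

theorem sum_upper_lower_zero (f : ℕ →₀ ℕ) :
    ∑ p ∈ ((upperStrips f 0).sigma fun g => lowerStrips g) with
        ¬ p.1 0 = max (f 0) (p.2 0), s p.2 * x ^ (p.1.degree - p.2.degree) = 0 := by
  refine Finset.sum_eq_zero ?_
  rintro ⟨g, h⟩ hp
  simp only [Finset.mem_filter, Finset.mem_sigma, mem_upperStrips, mem_lowerStrips] at hp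
  obtain ⟨⟨⟨h1, h2, h3⟩, h4, h5⟩, h0⟩ := hp
  have h6 : shapeTail f ≤ shapeTail g := fun i => h2 (i + 1)
  have h7 := Finsupp.degree_mono h6
  have hf0 := h2 0
  have hh0 := h5 0
  rw [degree_eq_add_shapeTail f, degree_eq_add_shapeTail g] at h3
  omega

end Commutation

/-- The Schur polynomial of shape `f` in the variables `x 0, …, x (n - 1)`, defined recursively by
removing horizontal strips. -/
noncomputable def branchingSchur {R : Type*} [CommRing R] (x : ℕ → R) : ℕ → (ℕ →₀ ℕ) → R
  | 0, f => if f = 0 then 1 else 0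
  | n + 1, f => ∑ g ∈ lowerStrips f, branchingSchur x n g * x n ^ (f.degree - g.degree)

section Pieri

open PowerSeries

variable {R : Type*} [CommRing R] (x : ℕ → R)

theorem pieri_step (n : ℕ) (f : ℕ →₀ ℕ) :
    (1 - C (x n) * X) *
        PowerSeries.mk (fun k => ∑ g ∈ upperStrips f k, branchingSchur x (n + 1) g) =
      ∑ g ∈ lowerStrips f, C (x n ^ (f.degree - g.degree)) *
        PowerSeries.mk (fun k => ∑ h ∈ upperStrips g k, branchingSchur x n h) := by
  ext k
  have key := fun k => sum_upper_lower_toggle (branchingSchur x n) (x n) f k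
  have split := fun k => Finset.sum_filter_add_sum_filter_not
    ((upperStrips f k).sigma fun g => lowerStrips g) (fun p => p.1 0 = max (f 0) (p.2 0))
    (fun p => branchingSchur x n p.2 * x n ^ (p.1.degree - p.2.degree))
  simp only [branchingSchur, Finset.sum_sigma', map_sum, coeff_C_mul, coeff_mk, sub_mul, one_mul,
    map_sub, mul_assoc, Finset.mul_sum]
  simp only [mul_comm (x n ^ _)]
  cases k with
  | zero =>
    rw [coeff_zero_X_mul, mul_zero, sub_zero, ← key, ← split, sum_upper_lower_zero, add_zero]
  | succ k =>
    rw [coeff_succ_X_mul, coeff_mk, ← key, ← split, sum_upper_lower_shorten]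
    ring

theorem pieri (n : ℕ) (f : ℕ →₀ ℕ) :
    (∏ i ∈ Finset.range n, (1 - C (x i) * X)) *
        PowerSeries.mk (fun k => ∑ g ∈ upperStrips f k, branchingSchur x n g) =
      C (branchingSchur x n f) := by
  induction n generalizing f with
  | zero =>
    ext k
    simp only [Finset.range_zero, Finset.prod_empty, one_mul, coeff_mk, branchingSchur, coeff_C]
    rw [Finset.sum_ite_eq']
    simp only [mem_upperStrips]
    have : (shapeTail 0 ≤ f ∧ f ≤ 0 ∧ (0 : ℕ →₀ ℕ).degree = f.degree + k) ↔ k = 0 ∧ f = 0 := by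
      constructor
      · rintro ⟨-, h1, h2⟩
        have : f = 0 := le_antisymm h1 (zero_le)
        subst this
        simp at h2
        exact ⟨h2.symm, rfl⟩
      · rintro ⟨rfl, rfl⟩
        refine ⟨fun i => by simp, le_rfl, by simp⟩
    rw [if_congr this rfl rfl]
    split_ifs <;> simp_all
  | succ n ih =>
    rw [Finset.prod_range_succ, mul_assoc, pieri_step, Finset.mul_sum]
    simp only [mul_left_comm _ (C (x n ^ _)), ih, branchingSchur, map_sum, map_mul]
    exact Finset.sum_congr rfl fun _ _ => mul_comm _ _

end Pieri

section Rounding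

/-- Replace the rows `2 * i` and `2 * i + 1` by two copies of row `2 * i`. -/
noncomputable def roundUp (f : ℕ →₀ ℕ) : ℕ →₀ ℕ :=
  Finsupp.onFinset (Finset.range (f.support.sup id + 2)) (fun i => f (2 * (i / 2))) fun i hi => by
    have := Finset.le_sup (f := id) (Finsupp.mem_support_iff.2 hi)
    simp only [id] at this
    rw [Finset.mem_range]
    omega

/-- Replace the rows `2 * i` and `2 * i + 1` by two copies of row `2 * i + 1`. -/
noncomputable def roundDown (f : ℕ →₀ ℕ) : ℕ →₀ ℕ :=
  Finsupp.onFinset (Finset.range (f.support.sup id + 2)) (fun i => f (2 * (i / 2) + 1))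
    fun i hi => by
      have := Finset.le_sup (f := id) (Finsupp.mem_support_iff.2 hi)
      simp only [id] at this
      rw [Finset.mem_range]
      omega

theorem roundUp_apply (f : ℕ →₀ ℕ) (i : ℕ) : roundUp f i = f (2 * (i / 2)) := rfl

theorem roundDown_apply (f : ℕ →₀ ℕ) (i : ℕ) : roundDown f i = f (2 * (i / 2) + 1) := rfl

theorem degree_eq_sum_range {f : ℕ →₀ ℕ} {N : ℕ} (h : ∀ i, N ≤ i → f i = 0) :
    f.degree = ∑ i ∈ Finset.range N, f i := by
  rw [Finsupp.degree_apply]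
  refine Finset.sum_subset (fun i hi => ?_) (fun i _ hi => by simpa using hi)
  by_contra hc
  exact Finsupp.mem_support_iff.1 hi (h i (by simpa using hc))

theorem degree_roundUp_add_degree_roundDown (f : ℕ →₀ ℕ) :
    (roundUp f).degree + (roundDown f).degree = 2 * f.degree := by
  obtain ⟨M, hM⟩ : ∃ M, ∀ i, M ≤ i → f i = 0 := by
    refine ⟨f.support.sup id + 1, fun i hi => ?_⟩
    by_contra hc
    have := Finset.le_sup (f := id) (Finsupp.mem_support_iff.2 hc)
    simp only [id] at this
    omega
  rw [degree_eq_sum_range (f := roundUp f) (N := 2 * M) fun i hi => hM _ (by omega),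
    degree_eq_sum_range (f := roundDown f) (N := 2 * M) fun i hi => hM _ (by omega),
    degree_eq_sum_range (f := f) (N := 2 * M) fun i hi => hM _ (by omega)]
  clear hM
  induction M with
  | zero => simp
  | succ M ih =>
    rw [show 2 * (M + 1) = 2 * M + 1 + 1 by ring]
    simp only [Finset.sum_range_succ, roundUp_apply, roundDown_apply] at ih ⊢
    rw [show (2 * M + 1) / 2 = M by omega, show 2 * M / 2 = M by omega]
    omega

/-- The partitions of `2 * l` whose rows come in pairs of equal length. -/
noncomputable def pairedShapes (l : ℕ) : Finset (ℕ →₀ ℕ) :=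
  open Classical in
  (Finset.finsuppAntidiag (Finset.range (2 * l)) (2 * l)).filter fun f =>
    Antitone f ∧ ∀ i, f (2 * i) = f (2 * i + 1)

theorem support_subset_range_degree {f : ℕ →₀ ℕ} (hf : Antitone f) :
    f.support ⊆ Finset.range f.degree := by
  intro i hi
  have h1 : Finset.range (i + 1) ⊆ f.support := fun j hj => by
    have := hf (Nat.lt_succ_iff.1 (Finset.mem_range.1 hj))
    have := Finsupp.mem_support_iff.1 hi
    rw [Finsupp.mem_support_iff]
    omega
  have h2 : f.support.card ≤ f.degree := by
    rw [Finsupp.degree_apply, Finset.card_eq_sum_ones]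
    exact Finset.sum_le_sum fun j hj => Nat.one_le_iff_ne_zero.2 (Finsupp.mem_support_iff.1 hj)
  have h3 := Finset.card_le_card h1
  rw [Finset.card_range] at h3
  exact Finset.mem_range.2 (by omega)

theorem mem_pairedShapes {f : ℕ →₀ ℕ} {l : ℕ} :
    f ∈ pairedShapes l ↔ f.degree = 2 * l ∧ Antitone f ∧ ∀ i, f (2 * i) = f (2 * i + 1) := by
  simp only [pairedShapes, Finset.mem_filter, Finset.mem_finsuppAntidiag]
  constructor
  · rintro ⟨⟨h1, h2⟩, h3⟩
    refine ⟨?_, h3⟩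
    rw [← h1, Finsupp.degree_apply]
    exact Finset.sum_subset h2 fun i _ hi => by simpa using hi
  · rintro ⟨h1, h2, h3⟩
    have h4 := support_subset_range_degree h2
    rw [h1] at h4
    refine ⟨⟨?_, h4⟩, h2, h3⟩
    refine Eq.trans ?_ h1
    rw [Finsupp.degree_apply]
    exact (Finset.sum_subset h4 fun i _ hi => by simpa using hi).symm

theorem antitone_of_mem_strips {f g : ℕ →₀ ℕ} (h1 : shapeTail f ≤ g) (h2 : g ≤ f) :
    Antitone f ∧ Antitone g :=
  ⟨antitone_nat_of_succ_le fun i => (h1 i).trans (h2 i),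
    antitone_nat_of_succ_le fun i => (h2 (i + 1)).trans (h1 i)⟩

theorem antitone_roundUp {f : ℕ →₀ ℕ} (hf : Antitone f) : Antitone (roundUp f) :=
  fun i j hij => hf (by omega)

theorem antitone_roundDown {f : ℕ →₀ ℕ} (hf : Antitone f) : Antitone (roundDown f) :=
  fun i j hij => hf (by omega)

theorem roundUp_paired (f : ℕ →₀ ℕ) (i : ℕ) : roundUp f (2 * i) = roundUp f (2 * i + 1) := by
  rw [roundUp_apply, roundUp_apply]
  congr 1
  omega

theorem roundDown_paired (f : ℕ →₀ ℕ) (i : ℕ) :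
    roundDown f (2 * i) = roundDown f (2 * i + 1) := by
  rw [roundDown_apply, roundDown_apply]
  congr 1
  omega

theorem le_roundUp {f : ℕ →₀ ℕ} (hf : Antitone f) : f ≤ roundUp f := fun i => hf (by omega)

theorem roundDown_le {f : ℕ →₀ ℕ} (hf : Antitone f) : roundDown f ≤ f := fun i => hf (by omega)

theorem shapeTail_roundUp_le {f : ℕ →₀ ℕ} (hf : Antitone f) : shapeTail (roundUp f) ≤ f :=
  fun i => hf (by omega)

theorem shapeTail_le_roundDown {f : ℕ →₀ ℕ} (hf : Antitone f) : shapeTail f ≤ roundDown f :=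
  fun i => hf (by omega)

theorem eq_roundUp {f g : ℕ →₀ ℕ} (h1 : shapeTail f ≤ g) (h2 : g ≤ f)
    (hf : ∀ i, f (2 * i) = f (2 * i + 1)) : f = roundUp g := by
  ext i
  rw [roundUp_apply]
  obtain ⟨m, hm⟩ := Nat.even_or_odd' i
  rw [show i / 2 = m by omega]
  have h3 := hf m
  have h4 := h1 (2 * m)
  have h5 := h2 (2 * m)
  rw [shapeTail_apply] at h4
  rcases hm with rfl | rfl <;> omega

theorem eq_roundDown {f g : ℕ →₀ ℕ} (h1 : shapeTail g ≤ f) (h2 : f ≤ g)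
    (hf : ∀ i, f (2 * i) = f (2 * i + 1)) : f = roundDown g := by
  ext i
  rw [roundDown_apply]
  obtain ⟨m, hm⟩ := Nat.even_or_odd' i
  rw [show i / 2 = m by omega]
  have h3 := hf m
  have h4 := h1 (2 * m)
  have h5 := h2 (2 * m + 1)
  rw [shapeTail_apply] at h4
  rcases hm with rfl | rfl <;> omega

theorem sum_pairedShapes_lower {R : Type*} [CommRing R] (s : (ℕ →₀ ℕ) → R) (x : R) (l : ℕ) :
    ∑ f ∈ pairedShapes l, ∑ g ∈ lowerStrips f, s g * x ^ (f.degree - g.degree) =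
      ∑ p ∈ Finset.HasAntidiagonal.antidiagonal l, ∑ f ∈ pairedShapes p.2, ∑ g ∈ upperStrips f p.1,
        s g * x ^ p.1 := by
  simp only [Finset.sum_sigma']
  refine Finset.sum_bij'
    (fun p _ => ⟨(p.1.degree - p.2.degree, l - (p.1.degree - p.2.degree)), roundDown p.2, p.2⟩)
    (fun p _ => ⟨roundUp p.2.2, p.2.2⟩) ?_ ?_ ?_ ?_ ?_
  · rintro ⟨f, g⟩ hp
    simp only [Finset.mem_sigma, mem_pairedShapes, mem_lowerStrips, mem_upperStrips,
      Finset.HasAntidiagonal.mem_antidiagonal] at hp ⊢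
    obtain ⟨⟨h1, h2, h3⟩, h4, h5⟩ := hp
    have hg := (antitone_of_mem_strips h4 h5).2
    have hd := degree_roundUp_add_degree_roundDown g
    rw [← eq_roundUp h4 h5 h3] at hd
    have hle := Finsupp.degree_mono h5
    exact ⟨by omega, ⟨by omega, antitone_roundDown hg, roundDown_paired g⟩,
      shapeTail_le_roundDown hg, roundDown_le hg, by omega⟩
  · rintro ⟨⟨k, j⟩, f, g⟩ hp
    simp only [Finset.mem_sigma, mem_pairedShapes, mem_lowerStrips, mem_upperStrips,
      Finset.HasAntidiagonal.mem_antidiagonal] at hp ⊢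
    obtain ⟨h0, ⟨h1, h2, h3⟩, h4, h5, h6⟩ := hp
    have hg := (antitone_of_mem_strips h4 h5).1
    have hd := degree_roundUp_add_degree_roundDown g
    rw [← eq_roundDown h4 h5 h3] at hd
    exact ⟨⟨by omega, antitone_roundUp hg, roundUp_paired g⟩, shapeTail_roundUp_le hg,
      le_roundUp hg⟩
  · rintro ⟨f, g⟩ hp
    simp only [Finset.mem_sigma, mem_pairedShapes, mem_lowerStrips] at hp
    obtain ⟨⟨h1, h2, h3⟩, h4, h5⟩ := hp
    simp only [← eq_roundUp h4 h5 h3]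
  · rintro ⟨⟨k, j⟩, f, g⟩ hp
    simp only [Finset.mem_sigma, mem_pairedShapes, mem_upperStrips,
      Finset.HasAntidiagonal.mem_antidiagonal] at hp
    obtain ⟨h0, ⟨h1, h2, h3⟩, h4, h5, h6⟩ := hp
    have hd := degree_roundUp_add_degree_roundDown g
    rw [← eq_roundDown h4 h5 h3] at hd
    have hk : (roundUp g).degree - g.degree = k := by omega
    have hj : l - k = j := by omega
    simp only [← eq_roundDown h4 h5 h3, hk, hj]
  · rintro ⟨f, g⟩ hp
    rfl

end Rounding

section GeneratingFunction

open PowerSeries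

variable {R : Type*} [CommRing R]

theorem one_sub_mul_mk_pow (a : R) : (1 - C a * X) * PowerSeries.mk (fun k => a ^ k) = 1 := by
  ext k
  cases k with
  | zero => simp [sub_mul, mul_assoc]
  | succ k => simp [sub_mul, mul_assoc, coeff_succ_X_mul, pow_succ', coeff_one]

/-- The generating function of the complete homogeneous polynomials in `x 0, …, x (n - 1)`. -/
noncomputable def homogeneousSeries (x : ℕ → R) (n : ℕ) : R⟦X⟧ :=
  ∏ i ∈ Finset.range n, PowerSeries.mk (fun k => x i ^ k)

theorem prod_one_sub_mul_homogeneousSeries (x : ℕ → R) (n : ℕ) :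
    (∏ i ∈ Finset.range n, (1 - C (x i) * X)) * homogeneousSeries x n = 1 := by
  rw [homogeneousSeries, ← Finset.prod_mul_distrib]
  exact Finset.prod_eq_one fun i _ => one_sub_mul_mk_pow _

theorem sum_upperStrips_branchingSchur (x : ℕ → R) (n : ℕ) (f : ℕ →₀ ℕ) (k : ℕ) :
    ∑ g ∈ upperStrips f k, branchingSchur x n g =
      coeff k (homogeneousSeries x n) * branchingSchur x n f := by
  have h := congrArg (homogeneousSeries x n * ·) (pieri x n f)
  simp only [← mul_assoc] at h
  rw [mul_comm (homogeneousSeries x n) (Finset.prod _ _), prod_one_sub_mul_homogeneousSeries,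
    one_mul] at h
  have := congrArg (coeff k) h
  rwa [coeff_mk, coeff_mul_C] at this

/-- The generating function of the sums of Schur polynomials over paired shapes. -/
noncomputable def pairedSeries (x : ℕ → R) (n : ℕ) : R⟦X⟧ :=
  PowerSeries.mk fun l => ∑ f ∈ pairedShapes l, branchingSchur x n f

theorem pairedSeries_zero (x : ℕ → R) : pairedSeries x 0 = 1 := by
  ext l
  simp only [pairedSeries, coeff_mk, branchingSchur, coeff_one]
  rw [Finset.sum_ite_eq']
  refine if_congr (mem_pairedShapes.trans ⟨fun h => ?_, fun h => ?_⟩) rfl rfl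
  · have := h.1
    simp at this
    omega
  · subst h
    exact ⟨by simp, fun _ _ _ => le_rfl, fun _ => rfl⟩

theorem pairedSeries_succ (x : ℕ → R) (n : ℕ) :
    pairedSeries x (n + 1) = rescale (x n) (homogeneousSeries x n) * pairedSeries x n := by
  ext l
  simp only [pairedSeries, coeff_mk, branchingSchur, coeff_mul, coeff_rescale]
  rw [sum_pairedShapes_lower]
  refine Finset.sum_congr rfl fun p _ => ?_
  rw [Finset.mul_sum]
  refine Finset.sum_congr rfl fun f _ => ?_
  rw [← Finset.sum_mul, sum_upperStrips_branchingSchur]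
  ring

theorem prod_one_sub_mul_pairedSeries (x : ℕ → R) (n : ℕ) :
    (∏ j ∈ Finset.range n, ∏ i ∈ Finset.range j, (1 - C (x i * x j) * X)) * pairedSeries x n =
      1 := by
  induction n with
  | zero => simp [pairedSeries_zero]
  | succ n ih =>
    have h := congrArg (rescale (x n)) (prod_one_sub_mul_homogeneousSeries x n)
    have hC (a : R) : rescale (x n) (C a) = C a := by
      ext k
      rw [coeff_rescale, coeff_C]
      split_ifs with hk <;> simp [hk]
    simp only [map_mul, map_prod, map_sub, map_one, rescale_X, hC, ← mul_assoc] at h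
    rw [Finset.prod_range_succ, pairedSeries_succ]
    simp only [map_mul]
    simp only [map_mul] at ih
    rw [mul_comm (rescale _ _), mul_mul_mul_comm, ih, one_mul]
    exact h

open MvPolynomial in
theorem aeval_hsymm {σ : Type*} [Fintype σ] [DecidableEq σ] (f : σ → R) (k : ℕ) :
    aeval f (hsymm σ ℤ k) = ∑ s : Sym σ k, ((s : Multiset σ).map f).prod := by
  simp [hsymm, map_sum, map_multiset_prod]

theorem prod_one_sub_mul_mk_sum_sym {σ : Type*} [Fintype σ] [DecidableEq σ] (f : σ → R) :
    (∏ p, (1 - C (f p) * X)) *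
      PowerSeries.mk (fun k => ∑ s : Sym σ k, ((s : Multiset σ).map f).prod) = 1 := by
  refine Fintype.induction_empty_option
    (P := fun σ _ => ∀ [DecidableEq σ] (f : σ → R), (∏ p, (1 - C (f p) * X)) *
      PowerSeries.mk (fun k => ∑ s : Sym σ k, ((s : Multiset σ).map f).prod) = 1) ?_ ?_ ?_ σ f
  · intro α β _ e h _ f
    classical
    let _ : Fintype α := Fintype.ofEquiv β e.symm
    refine Eq.trans ?_ (h fun a => f (e a))
    congr 1
    · exact (Fintype.prod_equiv e (fun a => 1 - C (f (e a)) * X) _ fun _ => rfl).symm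
    · ext k
      simp only [coeff_mk]
      refine (Fintype.sum_equiv (Sym.equivCongr e) _ _ fun s => ?_).symm
      simp [Sym.equivCongr, Sym.map, Multiset.map_map]
  · intro _ f
    ext k
    rw [Finset.univ_eq_empty, Finset.prod_empty, one_mul, coeff_mk, coeff_one]
    cases k with
    | zero => simp [Sym.eq_nil_of_card_zero]
    | succ k => simp
  · intro α _ ih _ f
    classical
    refine Eq.trans ?_ (ih fun a => f (some a))
    rw [Fintype.prod_option, mul_comm (1 - _), mul_assoc]
    congr 1
    ext k
    cases k with
    | zero => simp [sub_mul, mul_assoc, Sym.eq_nil_of_card_zero]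
    | succ k =>
      simp only [sub_mul, one_mul, mul_assoc, map_sub, coeff_mk, coeff_C_mul, coeff_succ_X_mul]
      rw [sub_eq_iff_eq_add, ← Equiv.sum_comp symOptionSuccEquiv.symm, Fintype.sum_sum_type,
        add_comm, Finset.mul_sum]
      congr 1
      · refine Finset.sum_congr rfl fun s _ => ?_
        simp [symOptionSuccEquiv, SymOptionSuccEquiv.decode, Multiset.map_map]
      · refine Finset.sum_congr rfl fun s _ => ?_
        simp [symOptionSuccEquiv, SymOptionSuccEquiv.decode, Sym.coe_cons]

end GeneratingFunction

section Tableaux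

/-- The row lengths of a Young diagram, as a finitely supported function. -/
noncomputable def rowShape (μ : YoungDiagram) : ℕ →₀ ℕ :=
  Finsupp.onFinset (Finset.range (μ.colLen 0)) μ.rowLen fun i hi => by
    rw [Finset.mem_range, ← YoungDiagram.mem_iff_lt_colLen, YoungDiagram.mem_iff_lt_rowLen]
    omega

@[simp]
theorem rowShape_apply (μ : YoungDiagram) (i : ℕ) : rowShape μ i = μ.rowLen i := rfl

theorem antitone_rowShape (μ : YoungDiagram) : Antitone (rowShape μ) :=
  fun i j h => μ.rowLen_anti i j h

theorem rowShape_injective : Function.Injective rowShape := by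
  intro μ ν h
  ext ⟨i, j⟩
  have := DFunLike.congr_fun h i
  simp only [rowShape_apply] at this
  rw [YoungDiagram.mem_cells, YoungDiagram.mem_cells, YoungDiagram.mem_iff_lt_rowLen,
    YoungDiagram.mem_iff_lt_rowLen, this]

theorem exists_rowShape_eq {f : ℕ →₀ ℕ} (hf : Antitone f) : ∃ μ, rowShape μ = f := by
  let μ : YoungDiagram :=
    { cells := (Finset.range (f.support.sup id + 1) ×ˢ Finset.range (f 0)).filter
        fun c => c.2 < f c.1
      isLowerSet := by
        rintro ⟨i, j⟩ ⟨i', j'⟩ ⟨h1, h2⟩ h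
        simp only [Finset.coe_filter, Finset.mem_product, Finset.mem_range,
          Set.mem_ofPred_eq] at h h1 h2 ⊢
        have := hf h1
        omega }
  have hμ (i j : ℕ) : (i, j) ∈ μ ↔ j < f i := by
    rw [← YoungDiagram.mem_cells]
    simp only [μ, Finset.mem_filter, Finset.mem_product, Finset.mem_range]
    refine ⟨fun h => h.2, fun h => ⟨⟨?_, h.trans_le (hf (Nat.zero_le i))⟩, h⟩⟩
    have := Finset.le_sup (f := id) (Finsupp.mem_support_iff.2 (show f i ≠ 0 by omega))
    simp only [id] at this
    omega
  refine ⟨μ, Finsupp.ext fun i => ?_⟩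
  rw [rowShape_apply]
  have h1 := hμ i (μ.rowLen i)
  have h2 := hμ i (f i)
  rw [YoungDiagram.mem_iff_lt_rowLen] at h1 h2
  omega

theorem degree_rowShape (μ : YoungDiagram) : (rowShape μ).degree = μ.card := by
  rw [degree_eq_sum_range (N := μ.colLen 0)]
  · rw [YoungDiagram.card, Finset.card_eq_sum_card_fiberwise (f := Prod.fst)
      (t := Finset.range (μ.colLen 0))]
    · exact Finset.sum_congr rfl fun i _ => μ.rowLen_eq_card
    · rintro ⟨i, j⟩ h
      have := μ.up_left_mem le_rfl (Nat.zero_le j) (μ.mem_cells _ |>.1 h)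
      simpa [YoungDiagram.mem_iff_lt_colLen] using this
  · intro i hi
    by_contra hc
    have : (i, 0) ∈ μ := YoungDiagram.mem_iff_lt_rowLen.2 (Nat.pos_of_ne_zero hc)
    rw [YoungDiagram.mem_iff_lt_colLen] at this
    omega

theorem finite_setOf_entries_lt (μ : YoungDiagram) (m : ℕ) :
    {T : SemistandardYoungTableau μ | ∀ c ∈ μ.cells, T c.1 c.2 < m}.Finite := by
  have hinj : Function.Injective
      fun (T : {T : SemistandardYoungTableau μ // ∀ c ∈ μ.cells, T c.1 c.2 < m})
        (c : μ.cells) => (⟨T.1 c.1.1 c.1.2, T.2 c.1 c.2⟩ : Fin m) := by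
    intro T T' h
    ext i j
    by_cases hc : (i, j) ∈ μ
    · simpa using congrFun h ⟨(i, j), (μ.mem_cells _).2 hc⟩
    · rw [T.1.zeros hc, T'.1.zeros hc]
  exact Finite.of_injective _ hinj

/-- The semistandard tableaux of shape `μ` with entries less than `m`. -/
noncomputable def boundedTableaux (μ : YoungDiagram) (m : ℕ) :
    Finset (SemistandardYoungTableau μ) :=
  (finite_setOf_entries_lt μ m).toFinset

theorem mem_boundedTableaux {μ : YoungDiagram} {m : ℕ} {T : SemistandardYoungTableau μ} :
    T ∈ boundedTableaux μ m ↔ ∀ i j, (i, j) ∈ μ → T i j < m := by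
  simp [boundedTableaux]

/-- The diagram formed by the cells of `T` with entry less than `m`. -/
def entriesBelow {μ : YoungDiagram} (T : SemistandardYoungTableau μ) (m : ℕ) : YoungDiagram where
  cells := μ.cells.filter fun c => T c.1 c.2 < m
  isLowerSet := by
    rintro ⟨i, j⟩ ⟨i', j'⟩ ⟨h1, h2⟩ h
    simp only [Finset.coe_filter, Set.mem_ofPred_eq, YoungDiagram.mem_cells] at h h1 h2 ⊢
    refine ⟨μ.up_left_mem h1 h2 h.1, lt_of_le_of_lt ?_ h.2⟩
    exact (T.row_weak_of_le h2 (μ.up_left_mem h1 le_rfl h.1)).trans (T.col_weak h1 h.1)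

theorem mem_entriesBelow {μ : YoungDiagram} {T : SemistandardYoungTableau μ} {m : ℕ} {i j : ℕ} :
    (i, j) ∈ entriesBelow T m ↔ (i, j) ∈ μ ∧ T i j < m := by
  rw [← YoungDiagram.mem_cells]
  simp [entriesBelow]

theorem rowShape_le_iff {μ ν : YoungDiagram} : rowShape μ ≤ rowShape ν ↔ μ ≤ ν := by
  constructor
  · rintro h ⟨i, j⟩ hc
    have := h i
    simp only [rowShape_apply, YoungDiagram.mem_iff_lt_rowLen] at *
    omega
  · intro h i
    by_contra hc
    have h1 : (i, ν.rowLen i) ∈ μ := YoungDiagram.mem_iff_lt_rowLen.2 (not_le.1 hc)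
    exact lt_irrefl _ (YoungDiagram.mem_iff_lt_rowLen.1 (h h1))

theorem shapeTail_rowShape_le_iff {μ ν : YoungDiagram} :
    shapeTail (rowShape μ) ≤ rowShape ν ↔ ∀ i j, (i + 1, j) ∈ μ → (i, j) ∈ ν := by
  simp only [YoungDiagram.mem_iff_lt_rowLen, Finsupp.le_def, shapeTail_apply, rowShape_apply]
  exact forall_congr' fun i => ⟨fun h j hj => hj.trans_le h, fun h => not_lt.1 fun hc =>
    lt_irrefl _ (h _ hc)⟩

theorem rowShape_entriesBelow_mem {μ : YoungDiagram} {T : SemistandardYoungTableau μ} {m : ℕ}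
    (hT : T ∈ boundedTableaux μ (m + 1)) :
    rowShape (entriesBelow T m) ∈ lowerStrips (rowShape μ) := by
  rw [mem_lowerStrips, shapeTail_rowShape_le_iff, rowShape_le_iff]
  rw [mem_boundedTableaux] at hT
  refine ⟨fun i j h => ?_, ?_⟩
  · rw [mem_entriesBelow]
    have h1 := T.col_strict (Nat.lt_succ_self i) h
    have h2 := hT _ _ h
    exact ⟨μ.up_left_mem (Nat.le_succ i) le_rfl h, by simp only [Nat.succ_eq_add_one] at h1; omega⟩
  · rintro ⟨i, j⟩ h
    exact (mem_entriesBelow.1 h).1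

/-- The restriction of a tableau to a smaller diagram. -/
def restrictTableau {μ ν : YoungDiagram} (hν : ν ≤ μ) (T : SemistandardYoungTableau μ) :
    SemistandardYoungTableau ν where
  entry i j := if (i, j) ∈ ν then T i j else 0
  row_weak' {i j1 j2} hj h := by
    rw [if_pos h, if_pos (ν.up_left_mem le_rfl hj.le h)]
    exact T.row_weak hj (hν h)
  col_strict' {i1 i2 j} hi h := by
    rw [if_pos h, if_pos (ν.up_left_mem hi.le le_rfl h)]
    exact T.col_strict hi (hν h)
  zeros' h := if_neg h

theorem restrictTableau_apply {μ ν : YoungDiagram} (hν : ν ≤ μ) (T : SemistandardYoungTableau μ)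
    (i j : ℕ) : restrictTableau hν T i j = if (i, j) ∈ ν then T i j else 0 := rfl

/-- The extension of a tableau by a horizontal strip filled with `m`. -/
def extendTableau {μ ν : YoungDiagram} {m : ℕ} (hν : ν ≤ μ)
    (hs : ∀ i j, (i + 1, j) ∈ μ → (i, j) ∈ ν) (T : SemistandardYoungTableau ν)
    (hT : ∀ i j, (i, j) ∈ ν → T i j < m) : SemistandardYoungTableau μ where
  entry i j := if (i, j) ∈ ν then T i j else if (i, j) ∈ μ then m else 0
  row_weak' {i j1 j2} hj h := by
    by_cases h2 : (i, j2) ∈ ν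
    · rw [if_pos h2, if_pos (ν.up_left_mem le_rfl hj.le h2)]
      exact T.row_weak hj h2
    · rw [if_neg h2, if_pos h, if_pos (μ.up_left_mem le_rfl hj.le h)]
      split_ifs with h1
      · exact (hT _ _ h1).le
      · exact le_rfl
  col_strict' {i1 i2 j} hi h := by
    have h1 : (i1, j) ∈ ν := hs _ _ (μ.up_left_mem (Nat.succ_le_of_lt hi) le_rfl h)
    rw [if_pos h1]
    split_ifs with h2
    · exact T.col_strict hi h2
    · exact hT _ _ h1
  zeros' {i j} h := by
    rw [if_neg fun h2 => h (hν h2), if_neg h]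

theorem extendTableau_apply {μ ν : YoungDiagram} {m : ℕ} (hν : ν ≤ μ)
    (hs : ∀ i j, (i + 1, j) ∈ μ → (i, j) ∈ ν) (T : SemistandardYoungTableau ν)
    (hT : ∀ i j, (i, j) ∈ ν → T i j < m) (i j : ℕ) :
    extendTableau hν hs T hT i j = if (i, j) ∈ ν then T i j else if (i, j) ∈ μ then m else 0 :=
  rfl

theorem ssytWeight_restrict_of_lt {μ ν : YoungDiagram} (hν : ν ≤ μ)
    (T : SemistandardYoungTableau μ) {m k : ℕ} (hT : entriesBelow T m = ν) (hk : k < m) :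
    ssytWeight (restrictTableau hν T) k = ssytWeight T k := by
  subst hT
  refine congrArg Finset.card (Finset.ext fun ⟨i, j⟩ => ?_)
  rw [Finset.mem_filter, Finset.mem_filter, YoungDiagram.mem_cells, YoungDiagram.mem_cells,
    restrictTableau_apply]
  constructor
  · rintro ⟨h1, h2⟩
    rw [if_pos h1] at h2
    exact ⟨(mem_entriesBelow.1 h1).1, h2⟩
  · rintro ⟨h1, h2⟩
    have h3 : (i, j) ∈ entriesBelow T m := mem_entriesBelow.2 ⟨h1, h2 ▸ hk⟩
    rw [if_pos h3]
    exact ⟨h3, h2⟩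

theorem ssytWeight_last {μ : YoungDiagram} {T : SemistandardYoungTableau μ} {m : ℕ}
    (hT : T ∈ boundedTableaux μ (m + 1)) :
    ssytWeight T m = μ.card - (entriesBelow T m).card := by
  have h := Finset.card_filter_add_card_filter_not (s := μ.cells) (fun c => T c.1 c.2 < m)
  have h1 : (μ.cells.filter fun c => ¬ T c.1 c.2 < m) = μ.cells.filter fun c => T c.1 c.2 = m := by
    refine Finset.filter_congr fun ⟨i, j⟩ hc => ?_
    have := mem_boundedTableaux.1 hT i j ((μ.mem_cells _).1 hc)
    dsimp only
    omega
  rw [h1] at h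
  rw [YoungDiagram.card, ← h]
  simp [ssytWeight, entriesBelow]

theorem sum_boundedTableaux {R : Type*} [CommRing R] (x : ℕ → R) (m : ℕ) (μ : YoungDiagram) :
    ∑ T ∈ boundedTableaux μ m, ∏ i ∈ Finset.range m, x i ^ ssytWeight T i =
      branchingSchur x m (rowShape μ) := by
  induction m generalizing μ with
  | zero =>
    simp only [Finset.range_zero, Finset.prod_empty, branchingSchur, Finset.sum_const, nsmul_eq_mul,
      mul_one]
    split_ifs with h
    · have hμ (i j : ℕ) : (i, j) ∉ μ := by
        rw [YoungDiagram.mem_iff_lt_rowLen, ← rowShape_apply, h]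
        simp
      have : boundedTableaux μ 0 = {default} := by
        ext T
        rw [mem_boundedTableaux, Finset.mem_singleton]
        refine ⟨fun _ => ?_, fun _ i j hc => absurd hc (hμ i j)⟩
        ext i j
        rw [T.zeros (hμ i j), SemistandardYoungTableau.zeros _ (hμ i j)]
      simp [this]
    · have : boundedTableaux μ 0 = ∅ := by
        refine Finset.eq_empty_of_forall_notMem fun T hT => h (Finsupp.ext fun i => ?_)
        by_contra hc
        exact absurd (mem_boundedTableaux.1 hT i 0
          (YoungDiagram.mem_iff_lt_rowLen.2 (Nat.pos_of_ne_zero hc))) (Nat.not_lt_zero _)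
      simp [this]
  | succ m ih =>
    rw [branchingSchur, ← Finset.sum_fiberwise_of_maps_to
      (fun T (hT : T ∈ boundedTableaux μ (m + 1)) => rowShape_entriesBelow_mem hT)]
    refine Finset.sum_congr rfl fun g hg => ?_
    rw [mem_lowerStrips] at hg
    obtain ⟨ν, rfl⟩ := exists_rowShape_eq (antitone_of_mem_strips hg.1 hg.2).2
    obtain ⟨hs, hν⟩ := hg
    rw [shapeTail_rowShape_le_iff] at hs
    rw [rowShape_le_iff] at hν
    rw [← ih, Finset.sum_mul]
    refine Finset.sum_bij' (fun T _ => restrictTableau hν T)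
      (fun T hT => extendTableau hν hs T (mem_boundedTableaux.1 hT)) ?_ ?_ ?_ ?_ ?_
    · intro T hT
      rw [Finset.mem_filter] at hT
      rw [mem_boundedTableaux]
      intro i j hc
      rw [restrictTableau_apply, if_pos hc]
      rw [← rowShape_injective hT.2] at hc
      exact (mem_entriesBelow.1 hc).2
    · intro T hT
      rw [Finset.mem_filter, mem_boundedTableaux]
      rw [mem_boundedTableaux] at hT
      constructor
      · intro i j hc
        rw [extendTableau_apply, if_pos hc]
        split_ifs with h
        · exact (hT _ _ h).trans (Nat.lt_succ_self m)
        · exact Nat.lt_succ_self m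
      · congr 1
        ext ⟨i, j⟩
        rw [YoungDiagram.mem_cells, YoungDiagram.mem_cells, mem_entriesBelow, extendTableau_apply]
        constructor
        · rintro ⟨h1, h2⟩
          by_contra hc
          rw [if_neg hc, if_pos h1] at h2
          exact lt_irrefl _ h2
        · intro h
          rw [if_pos h]
          exact ⟨hν h, hT _ _ h⟩
    · intro T hT
      rw [Finset.mem_filter, mem_boundedTableaux] at hT
      ext i j
      rw [extendTableau_apply, restrictTableau_apply]
      split_ifs with h1 h2
      · rfl
      · rw [← rowShape_injective hT.2, mem_entriesBelow] at h1
        have := hT.1 i j h2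
        have : ¬ T i j < m := fun h => h1 ⟨h2, h⟩
        omega
      · exact (T.zeros h2).symm
    · intro T hT
      ext i j
      rw [restrictTableau_apply, extendTableau_apply]
      split_ifs with h1
      · rfl
      · exact (T.zeros h1).symm
    · intro T hT
      rw [Finset.mem_filter] at hT
      have h := rowShape_injective hT.2
      rw [Finset.prod_range_succ, ssytWeight_last hT.1, h, degree_rowShape, degree_rowShape]
      congr 1
      refine Finset.prod_congr rfl fun i hi => ?_
      rw [ssytWeight_restrict_of_lt hν T h (Finset.mem_range.1 hi)]

theorem schurPoly_eq_branchingSchur (n : ℕ) (μ : YoungDiagram) :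
    schurPoly n μ = branchingSchur
      (fun i => if h : i < n then (MvPolynomial.X ⟨i, h⟩ : MvPolynomial (Fin n) ℤ) else 0) n
      (rowShape μ) := by
  rw [← sum_boundedTableaux, schurPoly]
  refine (finsum_mem_eq_finite_toFinset_sum _ (finite_setOf_entries_lt μ n)).trans ?_
  refine Finset.sum_congr rfl fun T _ => ?_
  rw [Finset.prod_range]
  simp

end Tableaux

section EvenMultiplicities

theorem even_count_iff_getD {l : List ℕ} (hl : l.Pairwise (· ≥ ·)) (hpos : ∀ a ∈ l, 0 < a) :
    (∀ r, Even (l.count r)) ↔ ∀ i, l.getD (2 * i) 0 = l.getD (2 * i + 1) 0 := by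
  match l with
  | [] => simp
  | [a] =>
    refine iff_of_false (fun h => ?_) fun h => ?_
    · simpa using h a
    · have h0 := h 0
      have := hpos a (by simp)
      simp at h0
      omega
  | a :: b :: t =>
    have hl' : t.Pairwise (· ≥ ·) := (List.pairwise_cons.1 (List.pairwise_cons.1 hl).2).2
    have ih := even_count_iff_getD hl' fun c hc => hpos c (by simp [hc])
    have h1 : (∀ i, (a :: b :: t).getD (2 * i) 0 = (a :: b :: t).getD (2 * i + 1) 0) ↔
        a = b ∧ ∀ i, t.getD (2 * i) 0 = t.getD (2 * i + 1) 0 := by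
      constructor
      · intro h
        exact ⟨by simpa using h 0, fun i => by simpa [mul_add] using h (i + 1)⟩
      · rintro ⟨h, h'⟩ i
        cases i with
        | zero => simpa using h
        | succ i => simpa [mul_add] using h' i
    rw [h1, ← ih]
    constructor
    · intro h
      have hab : a = b := by
        by_contra hne
        have h2 : a ∉ b :: t := by
          intro hm
          have h3 := (List.pairwise_cons.1 hl).1 b (by simp)
          rcases List.mem_cons.1 hm with h4 | h4
          · exact hne h4
          · have := (List.pairwise_cons.1 (List.pairwise_cons.1 hl).2).1 a h4
            omega
        have h5 := h a
        rw [List.count_cons_self, List.count_eq_zero_of_not_mem h2] at h5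
        simp at h5
      subst hab
      refine ⟨rfl, fun r => ?_⟩
      have h2 := h r
      simp only [List.count_cons] at h2
      split_ifs at h2 <;> grind
    · rintro ⟨rfl, h⟩ r
      have h2 := h r
      simp only [List.count_cons]
      split_ifs <;> grind

theorem even_count_rowLens_iff (μ : YoungDiagram) :
    (∀ r, Even (μ.rowLens.count r)) ↔ ∀ i, rowShape μ (2 * i) = rowShape μ (2 * i + 1) := by
  rw [even_count_iff_getD μ.rowLens_sorted.pairwise μ.pos_of_mem_rowLens]
  have h (i : ℕ) : μ.rowLens.getD i 0 = rowShape μ i := by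
    rw [List.getD_eq_getElem?_getD, rowShape_apply]
    by_cases hi : i < μ.rowLens.length
    · rw [List.getElem?_eq_getElem hi]
      exact YoungDiagram.get_rowLens
    · rw [List.getElem?_eq_none (by omega)]
      rw [YoungDiagram.length_rowLens] at hi
      by_contra hc
      exact hi (YoungDiagram.mem_iff_lt_colLen.1
        (YoungDiagram.mem_iff_lt_rowLen.2 (Nat.pos_of_ne_zero fun h0 => hc (by simp [h0]))))
  simp only [h]

theorem image_rowShape_eq_pairedShapes (l : ℕ) :
    rowShape '' {μ | μ.card = 2 * l ∧ ∀ r : ℕ, Even (μ.rowLens.count r)} = pairedShapes l := by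
  ext f
  simp only [Set.mem_image, Set.mem_ofPred_eq, Finset.mem_coe, mem_pairedShapes,
    even_count_rowLens_iff, ← degree_rowShape]
  constructor
  · rintro ⟨μ, h, rfl⟩
    exact ⟨h.1, antitone_rowShape μ, h.2⟩
  · rintro ⟨h1, h2, h3⟩
    obtain ⟨μ, rfl⟩ := exists_rowShape_eq h2
    exact ⟨μ, ⟨h1, h3⟩, rfl⟩

end EvenMultiplicities

open MvPolynomial in
/-- **Character identity for `Sym^l(∧² C^n)`.** The complete homogeneous symmetric polynomial
of degree `l` in the `n(n-1)/2` variables `{x_i x_j : i < j}` equals the sum of the Schur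
polynomials `s_λ(x_1,…,x_n)` over partitions `λ` of `2l` in which every part appears an even
number of times. -/
theorem sym_wedge_characters (n l : ℕ) (hn : 0 < n) :
    aeval (fun p : {p : Fin n × Fin n // p.1 < p.2} =>
          (X p.1.1 : MvPolynomial (Fin n) ℤ) * X p.1.2)
        (hsymm {p : Fin n × Fin n // p.1 < p.2} ℤ l) =
      ∑ᶠ (lam : YoungDiagram)
        (_ : lam.card = 2 * l ∧ ∀ r : ℕ, Even (lam.rowLens.count r)),
        schurPoly n lam := by
  set x : ℕ → MvPolynomial (Fin n) ℤ := fun i => if h : i < n then X ⟨i, h⟩ else 0 with hx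
  have hright : ∑ᶠ (lam : YoungDiagram)
      (_ : lam.card = 2 * l ∧ ∀ r : ℕ, Even (lam.rowLens.count r)), schurPoly n lam =
        PowerSeries.coeff l (pairedSeries x n) := by
    simp only [schurPoly_eq_branchingSchur, ← hx]
    have h := finsum_mem_image (f := branchingSchur x n) (g := rowShape)
      (s := {μ | μ.card = 2 * l ∧ ∀ r : ℕ, Even (μ.rowLens.count r)}) rowShape_injective.injOn
    rw [image_rowShape_eq_pairedShapes, finsum_mem_coe_finset] at h
    rw [pairedSeries, PowerSeries.coeff_mk, h]
    rfl
  refine Eq.trans (aeval_hsymm _ l) ?_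
  rw [hright]
  have h1 := prod_one_sub_mul_pairedSeries x n
  have h2 := prod_one_sub_mul_mk_sum_sym fun p : {p : Fin n × Fin n // p.1 < p.2} =>
    (X p.1.1 : MvPolynomial (Fin n) ℤ) * X p.1.2
  have h3 : ∏ j ∈ Finset.range n, ∏ i ∈ Finset.range j,
      (1 - PowerSeries.C (x i * x j) * PowerSeries.X) =
      ∏ p : {p : Fin n × Fin n // p.1 < p.2},
        (1 - PowerSeries.C ((X p.1.1 : MvPolynomial (Fin n) ℤ) * X p.1.2) * PowerSeries.X) := by
    rw [Finset.prod_sigma']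
    refine (Finset.prod_bij (fun p _ => ⟨p.1.2, p.1.1⟩) ?_ ?_ ?_ ?_).symm
    · intro p _
      simpa using p.2
    · rintro ⟨⟨i, j⟩, h⟩ _ ⟨⟨i', j'⟩, h'⟩ _ he
      simp only [Sigma.mk.injEq, heq_eq_eq, Fin.val_inj] at he
      simp [he.1, he.2]
    · rintro ⟨j, i⟩ h
      simp only [Finset.mem_sigma, Finset.mem_range] at h
      exact ⟨⟨(⟨i, h.2.trans h.1⟩, ⟨j, h.1⟩), h.2⟩, Finset.mem_univ _, rfl⟩
    · rintro ⟨⟨i, j⟩, h⟩ _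
      simp [hx]
  rw [h3] at h1
  have h4 := left_inv_eq_right_inv ((mul_comm _ _).trans h1) h2
  rw [h4, PowerSeries.coeff_mk]
end
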